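/- arXiv:2011.05044 — 3 statements merged into one kernel-verified Lean document; each statement's English description precedes it below -/
import Mathlib

section
/- Let M ⊂ ℂ² be a smooth real hypersurface given in a standard coordinate by 2Re(w) + F(z,z̄) + R₁(z,z̄)·Im(w) + R₂ = 0 with F(0)=0, ∇F(0)=0, ord(R₁) ≥ 1, |R₂| ≤ C|Im(w)|². If a nonconstant holomorphic curve γ : (ℂ,0) → (ℂ²,0) is tangent to M at 0 to infinite order, then γ is regular, i.e. ord(γ) = 1. -/
open Topology Asymptotics Filter

/-- A holomorphic germ whose real part is negligible with respect to the germ itself, up to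
terms vanishing to infinite order, is identically zero. -/
theorem AnalyticAt.eventually_eq_zero_of_re_isLittleO {d e : ℂ → ℂ} (hd : AnalyticAt ℂ d 0)
    (hd0 : d 0 = 0) (he : ∀ N : ℕ, e =O[𝓝 0] fun t : ℂ => t ^ N)
    (h : (fun t => ((d t).re : ℂ) - e t) =o[𝓝 0] d) : ∀ᶠ t in 𝓝 0, d t = 0 := by
  by_contra hne
  obtain ⟨m, v, hv, hv0, hdv⟩ := hd.exists_eventuallyEq_pow_smul_nonzero_iff.mpr hne
  simp only [sub_zero, smul_eq_mul] at hdv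
  have hm : m ≠ 0 := by
    rintro rfl
    have := hdv.self_of_nhds
    simp [hd0] at this
    exact hv0 this.symm
  have hdO : d =O[𝓝 0] fun t : ℂ => t ^ m := by
    refine IsBigO.congr' ?_ (EventuallyEq.symm hdv) EventuallyEq.rfl
    simpa using (isBigO_refl (fun t : ℂ => t ^ m) (𝓝 0)).mul
      (hv.continuousAt.norm.isBoundedUnder_le.isBigO_one ℂ)
  have hpow : (fun t : ℂ => t ^ (m + 1)) =o[𝓝 0] fun t : ℂ => t ^ m :=
    isLittleO_pow_pow (Nat.lt_succ_self m)
  have hre : (fun t => ((d t).re : ℂ)) =o[𝓝 0] fun t : ℂ => t ^ m := by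
    simpa using (h.trans_isBigO hdO).add ((he (m + 1)).trans_isLittleO hpow)
  obtain ⟨ζ, hζ⟩ := IsAlgClosed.exists_pow_nat_eq (v 0)⁻¹ (Nat.pos_of_ne_zero hm)
  have hray : Tendsto (fun r : ℝ => (r : ℂ) * ζ) (𝓝[≠] 0) (𝓝 0) := by
    have : ContinuousAt (fun r : ℝ => (r : ℂ) * ζ) 0 := by fun_prop
    simpa [ContinuousAt] using this.tendsto.mono_left nhdsWithin_le_nhds
  have hlim : Tendsto (fun r : ℝ => (ζ ^ m * v (r * ζ)).re) (𝓝[≠] 0) (𝓝 1) := by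
    have h1 : Tendsto (fun r : ℝ => ζ ^ m * v (r * ζ)) (𝓝[≠] 0) (𝓝 (ζ ^ m * v 0)) :=
      (hv.continuousAt.tendsto.comp hray).const_mul _
    have h2 : ζ ^ m * v 0 = 1 := by rw [hζ, inv_mul_cancel₀ hv0]
    rw [h2] at h1
    exact (Complex.continuous_re.tendsto 1).comp h1
  have hzero : Tendsto (fun r : ℝ => (ζ ^ m * v (r * ζ)).re) (𝓝[≠] 0) (𝓝 0) := by
    have h1 : (fun r : ℝ => ((d (r * ζ)).re : ℂ)) =o[𝓝[≠] 0] fun r : ℝ => r ^ m :=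
      (hre.comp_tendsto hray).trans_isBigO (.of_bound (‖ζ‖ ^ m) (.of_forall fun r => by
        simp [mul_pow, mul_comm]))
    have h2 : (fun r : ℝ => (d (r * ζ)).re) =o[𝓝[≠] 0] fun r : ℝ => r ^ m :=
      .of_norm_left (h1.norm_left.congr_left fun r => Complex.norm_real _)
    refine h2.tendsto_div_nhds_zero.congr' ?_
    filter_upwards [hray.eventually hdv, self_mem_nhdsWithin] with r hr hr0
    rw [hr, mul_pow, mul_assoc, ← Complex.ofReal_pow, Complex.re_ofReal_mul,
      mul_div_cancel_left₀ _ (pow_ne_zero m hr0)]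
  exact one_ne_zero (tendsto_nhds_unique hlim hzero)

theorem DifferentiableAt.hasDerivAt_id_mul {𝕜 : Type*} [NontriviallyNormedField 𝕜] {u : 𝕜 → 𝕜}
    (hu : DifferentiableAt 𝕜 u 0) : HasDerivAt (fun t => t * u t) (u 0) 0 := by
  simpa using! (hasDerivAt_id (0 : 𝕜)).mul hu.hasDerivAt

/-- A holomorphic germ with a critical point at `0` is invariant under a nontrivial
holomorphic change of the parameter. -/
theorem AnalyticAt.exists_comp_eventuallyEq_of_deriv_eq_zero {a : ℂ → ℂ} (ha : AnalyticAt ℂ a 0)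
    (ha0 : a 0 = 0) (hda : deriv a 0 = 0) :
    ∃ φ : ℂ → ℂ, AnalyticAt ℂ φ 0 ∧ φ 0 = 0 ∧ (∀ᶠ t in 𝓝[≠] 0, φ t ≠ t) ∧
      ∀ᶠ t in 𝓝 0, a (φ t) = a t := by
  by_cases hz : ∀ᶠ t in 𝓝 0, a t = 0
  · refine ⟨fun t => -t, analyticAt_id.neg, neg_zero, ?_, ?_⟩
    · filter_upwards [self_mem_nhdsWithin] with t ht
      exact fun h => ht (neg_eq_self.mp h)
    · have hneg : Tendsto (fun t : ℂ => -t) (𝓝 0) (𝓝 0) := by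
        simpa using (continuous_neg (G := ℂ)).tendsto 0
      filter_upwards [hz, hneg.eventually hz] with t h1 h2
      rw [h1, h2]
  obtain ⟨p, u, hu, hu0, hau⟩ := ha.exists_eventuallyEq_pow_smul_nonzero_iff.mpr hz
  simp only [sub_zero, smul_eq_mul] at hau
  have hp0 : p ≠ 0 := by
    rintro rfl
    have := hau.self_of_nhds
    simp [ha0] at this
    exact hu0 this.symm
  have hp1 : p ≠ 1 := by
    rintro rfl
    have h1 : HasDerivAt (fun t : ℂ => t ^ 1 * u t) (u 0) 0 := by
      simpa using! hu.differentiableAt.hasDerivAt_id_mul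
    exact hu0 (by rw [← h1.deriv, ← EventuallyEq.deriv_eq hau, hda])
  obtain ⟨c, hc⟩ := IsAlgClosed.exists_pow_nat_eq (u 0) (Nat.pos_of_ne_zero hp0)
  have hc0 : c ≠ 0 := by
    rintro rfl
    exact hu0 (by rw [← hc, zero_pow hp0])
  have hpC : (p : ℂ) ≠ 0 := Nat.cast_ne_zero.mpr hp0
  set v : ℂ → ℂ := fun t => c * Complex.exp (Complex.log (u t / u 0) / p) with hv
  have hva : AnalyticAt ℂ v 0 := by
    refine analyticAt_const.mul (AnalyticAt.cexp' ?_)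
    refine AnalyticAt.div (AnalyticAt.clog (hu.div analyticAt_const hu0) ?_) analyticAt_const hpC
    simp [hu0]
  have hv0 : v 0 ≠ 0 := mul_ne_zero hc0 (Complex.exp_ne_zero _)
  have hvp : ∀ᶠ t in 𝓝 0, v t ^ p = u t := by
    filter_upwards [hu.continuousAt.eventually_ne hu0] with t ht
    rw [hv]
    simp only
    rw [mul_pow, hc, ← Complex.exp_nat_mul, mul_div_cancel₀ _ hpC,
      Complex.exp_log (div_ne_zero ht hu0), mul_div_cancel₀ _ hu0]
  set g : ℂ → ℂ := fun t => t * v t with hg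
  have hga : AnalyticAt ℂ g 0 := analyticAt_id.mul hva
  have hg0 : g 0 = 0 := by simp [hg]
  have hdg : deriv g 0 ≠ 0 := by
    have h1 : HasDerivAt g (v 0) 0 := hva.differentiableAt.hasDerivAt_id_mul
    rwa [h1.deriv]
  have hag : ∀ᶠ t in 𝓝 0, a t = g t ^ p := by
    filter_upwards [hau, hvp] with t h1 h2
    rw [h1, hg, mul_pow, h2]
  obtain ⟨k, hk, hk0, hgk⟩ : ∃ k : ℂ → ℂ, AnalyticAt ℂ k 0 ∧ k 0 = 0 ∧
      ∀ᶠ s in 𝓝 0, g (k s) = s := by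
    have hs := hga.hasStrictDerivAt
    refine ⟨hs.localInverse g (deriv g 0) 0 hdg, ?_, ?_, ?_⟩
    · simpa [hg0] using hga.analyticAt_localInverse hdg
    · have := (HasStrictDerivAt.eventually_left_inverse hs hdg).self_of_nhds
      rwa [hg0] at this
    · have := HasStrictDerivAt.eventually_right_inverse hs hdg
      rwa [hg0] at this
  obtain ⟨ω, hω⟩ : ∃ ω : ℂ, IsPrimitiveRoot ω p := ⟨_, Complex.isPrimitiveRoot_exp p hp0⟩
  have hω1 : ω ≠ 1 := hω.ne_one (by omega)
  have hωg : AnalyticAt ℂ (fun t => ω * g t) 0 := analyticAt_const.mul hga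
  have hωg0 : ω * g 0 = 0 := by rw [hg0, mul_zero]
  have hωt : Tendsto (fun t => ω * g t) (𝓝 0) (𝓝 0) := by
    simpa [hg0] using hωg.continuousAt.tendsto
  have hφa : AnalyticAt ℂ (fun t => k (ω * g t)) 0 :=
    AnalyticAt.fun_comp (by rwa [hωg0]) hωg
  have hφ0 : k (ω * g 0) = 0 := by rw [hωg0, hk0]
  have hφt : Tendsto (fun t => k (ω * g t)) (𝓝 0) (𝓝 0) := by
    simpa [hφ0] using hφa.continuousAt.tendsto
  refine ⟨fun t => k (ω * g t), hφa, hφ0, ?_, ?_⟩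
  · filter_upwards [nhdsWithin_le_nhds (hωt.eventually hgk), self_mem_nhdsWithin,
      nhdsWithin_le_nhds (hva.continuousAt.eventually_ne hv0)] with t h1 ht hvt h
    rw [h] at h1
    have hgt : g t ≠ 0 := mul_ne_zero ht hvt
    exact hω1 (mul_right_cancel₀ hgt (by rw [one_mul]; exact h1.symm))
  · filter_upwards [hωt.eventually hgk, hag, hφt.eventually hag] with t h1 h2 h3
    rw [h3, h1, h2, mul_pow, hω.pow_eq_one, one_mul]

/-- A function bounded by `C |Im w|²` near the origin, and differentiable there, is critical. -/
theorem hasFDerivAt_zero_of_abs_le_im_sq {R : ℂ × ℂ → ℝ} {C : ℝ}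
    (h : ∀ᶠ q in 𝓝 (0 : ℂ × ℂ), |R q| ≤ C * q.2.im ^ 2) :
    HasFDerivAt R (0 : ℂ × ℂ →L[ℝ] ℝ) 0 := by
  have h0 : R 0 = 0 := by simpa using h.self_of_nhds
  have hO : R =O[𝓝 0] fun q : ℂ × ℂ => ‖q‖ ^ 2 := by
    refine .of_bound |C| ?_
    filter_upwards [h] with q hq
    have h1 : |q.2.im| ≤ ‖q‖ := (Complex.abs_im_le_norm _).trans (norm_snd_le q)
    have h2 : q.2.im ^ 2 ≤ ‖q‖ ^ 2 := by
      rw [← sq_abs]; gcongr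
    calc ‖R q‖ ≤ C * q.2.im ^ 2 := hq
      _ ≤ |C| * ‖q‖ ^ 2 := by
        gcongr
        exact le_abs_self C
      _ = |C| * ‖‖q‖ ^ 2‖ := by simp
  rw [hasFDerivAt_iff_isLittleO_nhds_zero]
  simpa [h0] using hO.trans_isLittleO (isLittleO_norm_pow_id one_lt_two)


/-- Let `M ⊆ ℂ²` be a smooth real hypersurface given in a standard
coordinate by the defining function
`r(z,w) = 2 Re w + F(z,z̄) + R₁(z,z̄)·Im w + R₂(z,w)` with `F(0)=0`, `∇F(0)=0`,
`ord R₁ ≥ 1` and `|R₂| ≤ C |Im w|²`. If a nonconstant holomorphic curve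
`γ : (ℂ,0) → (ℂ²,0)` (with good, i.e. injective, parametrization) is tangent to `M`
at `0` to infinite order, then `γ` is regular: `γ'(0) ≠ 0`. -/
theorem statement4 (F R₁ : ℂ → ℝ) (R₂ : ℂ × ℂ → ℝ) (C : ℝ)
    (hF : ContDiff ℝ (⊤ : ℕ∞) F) (hF0 : F 0 = 0) (hdF : fderiv ℝ F 0 = 0)
    (hR₁ : ContDiff ℝ (⊤ : ℕ∞) R₁) (hR₁0 : R₁ 0 = 0)
    (hR₂ : ContDiff ℝ (⊤ : ℕ∞) R₂)
    (hR₂bd : ∀ᶠ q in 𝓝 (0 : ℂ × ℂ), |R₂ q| ≤ C * q.2.im ^ 2)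
    (γ : ℂ → ℂ × ℂ) (hγ : AnalyticAt ℂ γ 0) (hγ0 : γ 0 = 0)
    (hnc : ¬ (∀ᶠ t in 𝓝 (0 : ℂ), γ t = 0))
    (hinj : ∃ U ∈ 𝓝 (0 : ℂ), Set.InjOn γ U)
    (htan : ∀ N : ℕ,
      (fun t => 2 * (γ t).2.re + F (γ t).1 + R₁ (γ t).1 * (γ t).2.im + R₂ (γ t))
        =O[𝓝 0] fun t : ℂ => t ^ N) :
    deriv γ 0 ≠ 0 := by
  intro hdγ
  have hγ1 : AnalyticAt ℂ (fun t => (γ t).1) 0 := analyticAt_fst.fun_comp hγ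
  have hγ2 : AnalyticAt ℂ (fun t => (γ t).2) 0 := analyticAt_snd.fun_comp hγ
  have hd : HasDerivAt γ 0 0 := hdγ ▸ hγ.differentiableAt.hasDerivAt
  have hd1 : deriv (fun t => (γ t).1) 0 = 0 :=
    ((ContinuousLinearMap.fst ℂ ℂ ℂ).hasFDerivAt.comp_hasDerivAt 0 hd).deriv.trans (by simp)
  obtain ⟨φ, hφ, hφ0, hφne, hφγ⟩ :=
    hγ1.exists_comp_eventuallyEq_of_deriv_eq_zero (by simp [hγ0]) hd1
  have hφt : Tendsto φ (𝓝 0) (𝓝 0) := by simpa [hφ0] using hφ.continuousAt.tendsto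
  have hγt : Tendsto γ (𝓝 0) (𝓝 0) := by simpa [hγ0] using hγ.continuousAt.tendsto
  set d : ℂ → ℂ := fun t => (γ (φ t)).2 - (γ t).2 with hd_def
  have hda : AnalyticAt ℂ d 0 :=
    (AnalyticAt.fun_comp (g := fun t => (γ t).2) (by rwa [hφ0]) hφ).sub hγ2
  have hd0 : d 0 = 0 := by simp [hd_def, hφ0]
  set r : ℂ → ℝ := fun t =>
    2 * (γ t).2.re + F (γ t).1 + R₁ (γ t).1 * (γ t).2.im + R₂ (γ t) with hr
  have hφO : φ =O[𝓝 0] fun t : ℂ => t := by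
    simpa [hφ0] using hφ.differentiableAt.isBigO_sub
  have he : ∀ N : ℕ, (fun t => (((r (φ t) - r t) / 2 : ℝ) : ℂ)) =O[𝓝 0] fun t : ℂ => t ^ N := by
    intro N
    have h1 : (fun t => r (φ t)) =O[𝓝 0] fun t : ℂ => t ^ N :=
      ((htan N).comp_tendsto hφt).trans (hφO.pow N)
    have h2 := (h1.sub (htan N)).const_mul_left (2⁻¹ : ℝ)
    refine IsBigO.of_norm_left (h2.norm_left.congr_left fun t => ?_)
    rw [Complex.norm_real, div_eq_inv_mul]
  have hR₁o : (fun t => R₁ (γ t).1 * (d t).im) =o[𝓝 0] d := by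
    have hlim : Tendsto (fun t => R₁ (γ t).1) (𝓝 0) (𝓝 0) := by
      have : ContinuousAt (fun t => R₁ (γ t).1) 0 :=
        hR₁.continuous.continuousAt.comp hγ1.continuousAt
      simpa [ContinuousAt, hγ0, hR₁0] using this
    have him : (fun t => (d t).im) =O[𝓝 0] d :=
      .of_bound 1 (.of_forall fun t => by simpa using Complex.abs_im_le_norm (d t))
    simpa using! (((isLittleO_one_iff ℝ).mpr hlim).mul_isBigO him.norm_right).norm_right
  have hR₂o : (fun t => R₂ (γ (φ t)) - R₂ (γ t)) =o[𝓝 0] d := by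
    have hs : HasStrictFDerivAt R₂ (0 : ℂ × ℂ →L[ℝ] ℝ) 0 :=
      hR₂.contDiffAt.hasStrictFDerivAt' (hasFDerivAt_zero_of_abs_le_im_sq hR₂bd) (by simp)
    have hpair : Tendsto (fun t => (γ (φ t), γ t)) (𝓝 0) (𝓝 ((0 : ℂ × ℂ), (0 : ℂ × ℂ))) :=
      (hγt.comp hφt).prodMk_nhds hγt
    have h1 := hs.isLittleO.comp_tendsto hpair
    refine (h1.norm_right.congr' (.of_forall fun t => by simp) ?_).of_norm_right
    filter_upwards [hφγ] with t ht
    simp [hd_def, Prod.norm_def, ht]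
  have hre : (fun t => ((d t).re : ℂ) - (((r (φ t) - r t) / 2 : ℝ) : ℂ)) =o[𝓝 0] d := by
    have h1 := ((hR₁o.add hR₂o).const_mul_left (-2⁻¹ : ℝ)).norm_left
    refine (h1.congr' ?_ EventuallyEq.rfl).of_norm_left
    filter_upwards [hφγ] with t ht
    rw [← Complex.ofReal_sub, Complex.norm_real]
    congr 1
    simp only [hr, hd_def, ht, Complex.sub_re, Complex.sub_im]
    ring
  have hdz := hda.eventually_eq_zero_of_re_isLittleO hd0 he hre
  obtain ⟨U, hU, hUinj⟩ := hinj
  have hfalse : ∀ᶠ t in 𝓝[≠] (0 : ℂ), False := by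
    filter_upwards [hφne, nhdsWithin_le_nhds hdz, nhdsWithin_le_nhds hφγ,
      nhdsWithin_le_nhds hU, nhdsWithin_le_nhds (hφt hU)] with t h1 h2 h3 h4 h5
    exact h1 (hUinj h5 h4 (Prod.ext h3 (sub_eq_zero.mp h2)))
  simpa using hfalse.exists
end

section
/- Let {c_j}_{j≥8} be positive reals such that ∑ c_j z^j has radius of convergence 0, let f be a smooth subharmonic function on ℂ with Taylor series 2∑_{j≥8} Re(c_j z^j), and let M ⊂ ℂ³ be defined by 2Re(w) + |z₁³ − z₂²|² + f(z₁,z̄₁) = 0. Then M is pseudoconvex, Δ₁(M,0) = ∞, Δ₁^{reg}(M,0) = 6 < ∞ (so M is of Bloom–Graham finite type at 0), yet no nonconstant holomorphic curve is tangent to M at 0 to infinite order. -/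
open Topology Asymptotics Filter Real

/-- `f` vanishes to order at least `k` at `0 ∈ ℂ`. -/
def ordGE {E : Type*} [NormedAddCommGroup E] (f : ℂ → E) (k : ℕ) : Prop :=
  f =O[𝓝 0] fun t : ℂ => t ^ k

/-- The D'Angelo type `Δ₁({r = 0}, p)` is infinite. -/
def DAngeloTypeInfinite {E : Type*} [NormedAddCommGroup E] [NormedSpace ℂ E]
    (r : E → ℝ) (p : E) : Prop :=
  ∀ C : ℕ, ∃ γ : ℂ → E, AnalyticAt ℂ γ 0 ∧ γ 0 = p ∧
    ¬ (∀ᶠ t in 𝓝 (0 : ℂ), γ t = p) ∧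
    ∃ m : ℕ, 1 ≤ m ∧ ¬ ordGE (fun t => γ t - p) (m + 1) ∧
      ordGE (fun t => r (γ t)) (C * m)

/-- Sub-mean value inequality on every complex line (plurisubharmonicity, for
continuous functions). -/
def Plurisubharmonic {E : Type*} [NormedAddCommGroup E] [NormedSpace ℂ E]
    (F : E → ℝ) : Prop :=
  ∀ a b : E, F a ≤ (2 * π)⁻¹ * ∫ θ in (0 : ℝ)..(2 * π),
    F (a + Complex.exp ((θ : ℂ) * Complex.I) • b)

lemma plurisubharmonic_iff_le_circleAverage {E : Type*} [NormedAddCommGroup E] [NormedSpace ℂ E]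
    {F : E → ℝ} :
    Plurisubharmonic F ↔ ∀ a b : E, F a ≤ circleAverage (fun ζ : ℂ => F (a + ζ • b)) 0 1 := by
  simp [Plurisubharmonic, circleAverage, circleMap]

lemma Continuous.circleIntegrable_comp_line {E : Type*} [NormedAddCommGroup E] [NormedSpace ℂ E]
    {F : E → ℝ} (hF : Continuous F) (a b : E) :
    CircleIntegrable (fun ζ : ℂ => F (a + ζ • b)) 0 1 :=
  (by fun_prop : Continuous fun ζ : ℂ => F (a + ζ • b)).continuousOn.circleIntegrable'

lemma Plurisubharmonic.add {E : Type*} [NormedAddCommGroup E] [NormedSpace ℂ E] {F G : E → ℝ}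
    (hF : Plurisubharmonic F) (hG : Plurisubharmonic G) (hFc : Continuous F) (hGc : Continuous G) :
    Plurisubharmonic (fun p => F p + G p) := by
  rw [plurisubharmonic_iff_le_circleAverage] at *
  intro a b
  rw [circleAverage_fun_add (hFc.circleIntegrable_comp_line a b)
    (hGc.circleIntegrable_comp_line a b)]
  exact add_le_add (hF a b) (hG a b)

lemma circleAverage_comp_line {E : Type*} [NormedAddCommGroup E] [NormedSpace ℂ E] {H : E → ℂ}
    (hH : Differentiable ℂ H) (a b : E) :
    circleAverage (fun ζ : ℂ => H (a + ζ • b)) 0 1 = H a := by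
  have h : Differentiable ℂ fun ζ : ℂ => H (a + ζ • b) := by fun_prop
  simpa using h.diffContOnCl.circleAverage (c := 0) (R := 1)

lemma Differentiable.plurisubharmonic_re {E : Type*} [NormedAddCommGroup E] [NormedSpace ℂ E]
    {H : E → ℂ} (hH : Differentiable ℂ H) : Plurisubharmonic fun p => (H p).re := by
  rw [plurisubharmonic_iff_le_circleAverage]
  intro a b
  have hc : Continuous fun ζ : ℂ => H (a + ζ • b) := by
    have := hH.continuous
    fun_prop
  have := Complex.reCLM.circleAverage_comp_comm (c := 0) (R := 1)
    (f := fun ζ : ℂ => H (a + ζ • b)) hc.continuousOn.circleIntegrable'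
  rw [circleAverage_comp_line hH] at this
  exact this.ge

lemma Differentiable.plurisubharmonic_normSq {E : Type*} [NormedAddCommGroup E]
    [NormedSpace ℂ E] {H : E → ℂ} (hH : Differentiable ℂ H) :
    Plurisubharmonic fun p => Complex.normSq (H p) := by
  rw [plurisubharmonic_iff_le_circleAverage]
  intro a b
  have h := circleAverage_comp_line (hH.pow 2) a b
  simp only [circleAverage, Pi.pow_apply] at h ⊢
  rw [Complex.normSq_eq_norm_sq, ← norm_pow, ← h, norm_smul, smul_eq_mul, norm_of_nonneg
    (by positivity)]
  gcongr
  refine (intervalIntegral.norm_integral_le_integral_norm (by positivity)).trans_eq ?_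
  simp [Complex.normSq_eq_norm_sq]

lemma Plurisubharmonic.comp_fst {E E' : Type*} [NormedAddCommGroup E] [NormedSpace ℂ E]
    [NormedAddCommGroup E'] [NormedSpace ℂ E'] {F : E → ℝ} (hF : Plurisubharmonic F) :
    Plurisubharmonic fun p : E × E' => F p.1 :=
  fun a b => hF a.1 b.1

lemma AnalyticAt.isTheta_pow_of_analyticOrderAt_eq {h : ℂ → ℂ} (hh : AnalyticAt ℂ h 0) {k : ℕ}
    (hk : analyticOrderAt h 0 = k) : h =Θ[𝓝 0] fun t : ℂ => t ^ k := by
  obtain ⟨u, hu, hu0, hhu⟩ := hh.analyticOrderAt_eq_natCast.1 hk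
  have hu1 : u =Θ[𝓝 0] fun _ => (1 : ℂ) :=
    (isTheta_of_div_tendsto_nhds_ne_zero (by simpa using hu.continuousAt.tendsto) hu0).symm
  have hmul : (fun t => t ^ k * u t) =Θ[𝓝 0] fun t : ℂ => t ^ k * 1 := isTheta_rfl.mul hu1
  simp only [mul_one] at hmul
  exact (show h =ᶠ[𝓝 0] fun t => t ^ k * u t from hhu.mono fun t ht => by simpa using ht).trans_isTheta hmul

lemma isBigO_pow_pow_iff {m n : ℕ} :
    ((fun t : ℂ => t ^ n) =O[𝓝 0] fun t => t ^ m) ↔ m ≤ n := by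
  refine ⟨fun hO => ?_, fun hmn => ?_⟩
  · by_contra! hlt
    refine hO.not_isLittleO ?_ (isLittleO_pow_pow hlt)
    exact (Filter.Eventually.frequently (f := 𝓝[≠] (0 : ℂ))
      (eventually_mem_nhdsWithin.mono fun t ht => pow_ne_zero n ht)).filter_mono nhdsWithin_le_nhds
  · rcases hmn.eq_or_lt with rfl | hlt
    · exact isBigO_refl _ _
    · exact (isLittleO_pow_pow hlt).isBigO

lemma AnalyticAt.isBigO_pow_iff {h : ℂ → ℂ} (hh : AnalyticAt ℂ h 0) {n : ℕ} :
    (h =O[𝓝 0] fun t : ℂ => t ^ n) ↔ (n : ℕ∞) ≤ analyticOrderAt h 0 := by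
  cases hk : analyticOrderAt h 0 with
  | top =>
    simp only [le_top, iff_true]
    exact (show h =ᶠ[𝓝 0] fun _ => (0 : ℂ) from analyticOrderAt_eq_top.1 hk).trans_isBigO
      (isBigO_zero _ _)
  | coe k =>
    rw [(hh.isTheta_pow_of_analyticOrderAt_eq hk).isBigO_congr_left, Nat.cast_le,
      isBigO_pow_pow_iff]

lemma isBigO_pow_of_re_isBigO {w : ℂ → ℂ} (hw : AnalyticAt ℂ w 0) (hw0 : w 0 = 0) {n : ℕ}
    (hre : (fun t => (w t).re) =O[𝓝 0] fun t : ℂ => t ^ n) :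
    w =O[𝓝 0] fun t : ℂ => t ^ n := by
  obtain ⟨C, hC, hb⟩ := hre.exists_pos
  obtain ⟨ε, hε, hball⟩ := Metric.eventually_nhds_iff_ball.1
    (hb.bound.and hw.eventually_analyticAt)
  refine IsBigO.of_bound (2 * C * 2 ^ n) ?_
  filter_upwards [Metric.ball_mem_nhds (0 : ℂ) (half_pos hε)] with z hz
  rw [mem_ball_zero_iff] at hz
  rcases eq_or_ne z 0 with rfl | hz0
  · simp only [hw0, norm_zero]; positivity
  have hzpos : 0 < ‖z‖ := norm_pos_iff.2 hz0
  have hsub : ∀ x ∈ Metric.ball (0 : ℂ) (2 * ‖z‖), x ∈ Metric.ball (0 : ℂ) ε := fun x hx =>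
    Metric.ball_subset_ball (by linarith) hx
  have := Complex.borelCaratheodory_zero (f := w) (R := 2 * ‖z‖) (M := C * (2 * ‖z‖) ^ n) (z := z)
    (by positivity)
    (fun x hx => (hball x (hsub x hx)).2.differentiableAt.differentiableWithinAt)
    (fun x hx => ?_) (by positivity) (by rw [mem_ball_zero_iff]; linarith) hw0
  · refine this.trans_eq ?_
    rw [norm_pow]
    field_simp
    ring
  · refine (le_abs_self _).trans ((hball x (hsub x hx)).1.trans ?_)
    rw [mem_ball_zero_iff] at hx
    rw [norm_pow]
    gcongr

lemma analyticOrderAt_ne_of_re_add_normSq_isBigO {w h : ℂ → ℂ} (hw : AnalyticAt ℂ w 0)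
    (hw0 : w 0 = 0) (hh : AnalyticAt ℂ h 0) {k n : ℕ} (hkn : 2 * k < n)
    (hO : (fun t => 2 * (w t).re + Complex.normSq (h t)) =O[𝓝 0] fun t : ℂ => t ^ n) :
    analyticOrderAt h 0 ≠ k := by
  intro hk
  obtain ⟨A, hA, hlow⟩ := (hh.isTheta_pow_of_analyticOrderAt_eq hk).2.exists_pos
  have hsmall := (hO.trans_isLittleO (isLittleO_pow_pow hkn)).bound
    (show 0 < 1 / (2 * A ^ 2) by positivity)
  have key : ∀ᶠ t in 𝓝 (0 : ℂ), (w t).re ≤ -(1 / (4 * A ^ 2)) * ‖t‖ ^ (2 * k) := by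
    filter_upwards [hsmall, hlow.bound] with t h1 h2
    rw [norm_pow] at h1 h2
    have h3 : ‖t‖ ^ (2 * k) ≤ A ^ 2 * ‖h t‖ ^ 2 := by
      rw [mul_comm 2 k, pow_mul, ← mul_pow]
      gcongr
    have h4 := (le_abs_self _).trans h1
    rw [Complex.normSq_eq_norm_sq] at h4
    have h5 : 1 / A ^ 2 * ‖t‖ ^ (2 * k) ≤ ‖h t‖ ^ 2 := by
      rw [one_div_mul_eq_div, div_le_iff₀ (by positivity)]; linarith
    have h6 : 1 / (2 * A ^ 2) = 1 / A ^ 2 / 2 := by field_simp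
    have h7 : 1 / (4 * A ^ 2) = 1 / A ^ 2 / 4 := by field_simp
    rw [h6] at h4
    rw [h7]
    linarith
  have hmax : IsLocalMax (norm ∘ fun t => Complex.exp (w t)) 0 := by
    filter_upwards [key] with t ht
    simp only [Function.comp_apply, Complex.norm_exp, hw0, Complex.zero_re]
    refine Real.exp_le_exp.2 (ht.trans ?_)
    have : 0 ≤ 1 / (4 * A ^ 2) * ‖t‖ ^ (2 * k) := by positivity
    linarith
  have hconst := Complex.eventually_eq_of_isLocalMax_norm
    (hw.eventually_analyticAt.mono fun t ht => ht.differentiableAt.cexp) hmax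
  have hzero : ∀ᶠ t in 𝓝[≠] (0 : ℂ), False := by
    filter_upwards [self_mem_nhdsWithin, nhdsWithin_le_nhds hconst, nhdsWithin_le_nhds key]
      with t ht h1 h2
    have h3 := congrArg norm h1
    simp only [Complex.norm_exp, hw0, Complex.zero_re, Real.exp_eq_exp] at h3
    have : 0 < 1 / (4 * A ^ 2) * ‖t‖ ^ (2 * k) := by
      have := norm_pos_iff.2 ht
      positivity
    linarith
  exact hzero.exists.elim fun _ => id

lemma exists_norm_le_of_isBigO_pow {g w : ℂ → ℂ} (hg : AnalyticAt ℂ g 0) (hw : AnalyticAt ℂ w 0)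
    (hg0 : g 0 = 0) (hgne : ¬ ∀ᶠ t in 𝓝 (0 : ℂ), g t = 0) {a : ℕ → ℂ}
    (hO : ∀ k, (fun t => w t - ∑ j ∈ Finset.range k, a j * g t ^ j) =O[𝓝 0] fun t => g t ^ k) :
    ∃ B K : ℝ, 0 < K ∧ ∀ k, ‖a k‖ ≤ B * K ^ k := by
  have hne := hg.eventually_eq_zero_or_eventually_ne_zero.resolve_left hgne
  obtain ⟨ε, hε, hball⟩ := Metric.eventually_nhds_iff_ball.1
    ((hw.eventually_analyticAt.and hg.eventually_analyticAt).and
      (eventually_nhdsWithin_iff.1 hne))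
  have hρ : 0 < ε / 2 := half_pos hε
  have hsub : Metric.closedBall (0 : ℂ) (ε / 2) ⊆ Metric.ball 0 ε :=
    Metric.closedBall_subset_ball (half_lt_self hε)
  have hsph : Metric.sphere (0 : ℂ) (ε / 2) ⊆ Metric.ball 0 ε :=
    Metric.sphere_subset_closedBall.trans hsub
  have hsph0 : ∀ t ∈ Metric.sphere (0 : ℂ) (ε / 2), g t ≠ 0 := fun t ht =>
    (hball t (hsph ht)).2 (ne_of_mem_of_not_mem ht (by simp [hρ.ne]))
  have hcompact : IsCompact (Metric.sphere (0 : ℂ) (ε / 2)) := isCompact_sphere _ _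
  obtain ⟨B, hB⟩ := hcompact.exists_bound_of_continuousOn (f := w) fun t ht =>
    (hball t (hsph ht)).1.1.continuousAt.continuousWithinAt
  obtain ⟨t₀, ht₀, hmin⟩ := hcompact.exists_isMinOn
    (NormedSpace.sphere_nonempty.2 hρ.le) (f := fun t => ‖g t‖) fun t ht =>
      (hball t (hsph ht)).1.2.continuousAt.norm.continuousWithinAt
  have hδ : 0 < ‖g t₀‖ := norm_pos_iff.2 (hsph0 t₀ ht₀)
  set R : ℕ → ℂ → ℂ := fun k t => (w t - ∑ j ∈ Finset.range k, a j * g t ^ j) / g t ^ k with hR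
  have hsucc : ∀ k t, g t ≠ 0 → R (k + 1) t = (R k t - a k) / g t := fun k t ht => by
    simp only [hR, Finset.sum_range_succ]
    field_simp
    ring
  have hlim : ∀ k, Tendsto (R k) (𝓝[≠] 0) (𝓝 (a k)) := fun k => by
    have hgt : Tendsto g (𝓝[≠] 0) (𝓝 0) := by
      simpa [hg0] using hg.continuousAt.tendsto.mono_left nhdsWithin_le_nhds
    have h1 : (R (k + 1)) =O[𝓝[≠] 0] fun _ => (1 : ℂ) := by
      refine (((hO (k + 1)).mono nhdsWithin_le_nhds).mul
        (isBigO_refl (fun t => (g t ^ (k + 1))⁻¹) _)).congr' (by simp [hR, div_eq_mul_inv]) ?_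
      filter_upwards [hne] with t ht
      rw [mul_inv_cancel₀ (pow_ne_zero _ ht)]
    have h2 : (fun t => R k t - a k) =O[𝓝[≠] 0] g := by
      refine (h1.mul (isBigO_refl g _)).congr' ?_ (by simp)
      filter_upwards [hne] with t ht
      rw [hsucc k t ht, div_mul_cancel₀ _ ht]
    simpa using (h2.trans_tendsto hgt).add_const (a k)
  have hdiff : ∀ k, DifferentiableOn ℂ (Function.update (R k) 0 (a k)) (Metric.ball 0 ε) :=
    fun k => by
    refine (Complex.differentiableOn_compl_singleton_and_continuousAt_iff
      (Metric.ball_mem_nhds 0 hε)).1 ⟨?_, continuousAt_update_same.2 (hlim k)⟩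
    have : DifferentiableOn ℂ (R k) (Metric.ball 0 ε \ {0}) := fun t ht => by
      have hgd := (hball t ht.1).1.2.differentiableAt
      have hwd := (hball t ht.1).1.1.differentiableAt
      refine DifferentiableAt.differentiableWithinAt (DifferentiableAt.div ?_ (hgd.pow k)
        (pow_ne_zero _ ((hball t ht.1).2 ht.2)))
      fun_prop
    exact this.congr fun t ht => Function.update_of_ne ht.2 _ _
  have hcoeff : ∀ k C, (∀ t ∈ Metric.sphere (0 : ℂ) (ε / 2), ‖R k t‖ ≤ C) → ‖a k‖ ≤ C :=
    fun k C hC => by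
    have := Complex.norm_le_of_forall_mem_frontier_norm_le (U := Metric.ball (0 : ℂ) (ε / 2))
      (f := Function.update (R k) 0 (a k)) (z := 0) (C := C) Metric.isBounded_ball
      (((hdiff k).mono (by rwa [closure_ball _ hρ.ne'])).diffContOnCl) (fun t ht => ?_)
      (subset_closure (Metric.mem_ball_self hρ))
    · simpa using this
    · rw [frontier_ball _ hρ.ne'] at ht
      rw [Function.update_of_ne (ne_of_mem_of_not_mem ht (by simp [hρ.ne]))]
      exact hC t ht
  have hbound : ∀ k, ∀ t ∈ Metric.sphere (0 : ℂ) (ε / 2),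
      ‖R k t‖ ≤ B * (2 / ‖g t₀‖) ^ k := fun k => by
    induction k with
    | zero => simpa [hR] using hB
    | succ k ih =>
      intro t ht
      have h1 := ih t ht
      have h2 := hcoeff k _ ih
      rw [hsucc k t (hsph0 t ht), norm_div]
      calc ‖R k t - a k‖ / ‖g t‖
          ≤ (B * (2 / ‖g t₀‖) ^ k + B * (2 / ‖g t₀‖) ^ k) / ‖g t₀‖ := by
            refine div_le_div₀ (add_nonneg ?_ ?_) ((norm_sub_le _ _).trans (add_le_add h1 h2)) hδ
              (hmin ht) <;> exact (norm_nonneg _).trans h2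
        _ = _ := by rw [pow_succ]; ring
  exact ⟨B, 2 / ‖g t₀‖, by positivity, fun k => hcoeff k _ (hbound k)⟩

lemma exists_summable_of_norm_le {a : ℕ → ℂ} {B K : ℝ} (hK : 0 < K)
    (ha : ∀ k, ‖a k‖ ≤ B * K ^ k) : ∃ z : ℂ, z ≠ 0 ∧ Summable fun k => a k * z ^ k := by
  refine ⟨((2 * K)⁻¹ : ℝ), by exact_mod_cast (by positivity : (2 * K)⁻¹ ≠ 0), ?_⟩
  refine Summable.of_norm_bounded (g := fun k => B * (1 / 2) ^ k)
    (summable_geometric_two.mul_left B) fun k => ?_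
  rw [norm_mul, norm_pow, Complex.norm_real, Real.norm_of_nonneg (by positivity)]
  calc ‖a k‖ * (2 * K)⁻¹ ^ k ≤ B * K ^ k * (2 * K)⁻¹ ^ k := by gcongr; exact ha k
    _ = B * (1 / 2) ^ k := by
      rw [mul_assoc, ← mul_pow]; congr 2; field_simp

lemma AnalyticAt.isBigO_id {g : ℂ → ℂ} (hg : AnalyticAt ℂ g 0) (hg0 : g 0 = 0) :
    g =O[𝓝 0] fun t : ℂ => t := by
  simpa [hg0] using hg.differentiableAt.isBigO_sub

lemma sum_sub_sum_isBigO_pow (c : ℕ → ℝ) {k N : ℕ} (hkN : k ≤ N) :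
    (fun z : ℂ => (∑ j ∈ Finset.range N, (c j : ℂ) * z ^ j)
      - ∑ j ∈ Finset.range k, (c j : ℂ) * z ^ j) =O[𝓝 0] fun z => z ^ k := by
  simp only [← Finset.sum_Ico_eq_sub _ hkN]
  exact IsBigO.fun_sum fun j hj =>
    (isBigO_pow_pow_iff.2 (Finset.mem_Ico.1 hj).1).const_mul_left _

lemma taylor_comp_isBigO {c : ℕ → ℝ} {f : ℂ → ℝ}
    (hTaylor : ∀ N : ℕ,
      (fun z : ℂ => f z - ∑ j ∈ Finset.range N, 2 * ((c j : ℂ) * z ^ j).re)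
        =O[𝓝 0] fun z => z ^ N)
    {g : ℂ → ℂ} (hg : AnalyticAt ℂ g 0) (hg0 : g 0 = 0) (N : ℕ) :
    (fun t => f (g t) - 2 * (∑ j ∈ Finset.range N, (c j : ℂ) * g t ^ j).re)
      =O[𝓝 0] fun t : ℂ => t ^ N := by
  have h := ((hTaylor N).comp_tendsto
    (by simpa [hg0] using hg.continuousAt.tendsto : Tendsto g (𝓝 0) (𝓝 0))).trans
    ((hg.isBigO_id hg0).pow N)
  simpa only [Function.comp_def, Complex.re_sum, Finset.mul_sum] using h

lemma deriv_eq_zero_of_two_le_analyticOrderAt {h : ℂ → ℂ} (hh : AnalyticAt ℂ h 0)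
    (h0 : h 0 = 0) (h2 : 2 ≤ analyticOrderAt h 0) : deriv h 0 = 0 := by
  by_contra hd
  rw [hh.analyticOrderAt_eq_one_of_zero_deriv_ne_zero h0 hd] at h2
  exact absurd h2 (by decide)

lemma sum_range_eq_zero_of_forall_lt {c : ℕ → ℝ} (hlow : ∀ j < 8, c j = 0) {N : ℕ} (hN : N ≤ 8)
    (z : ℂ) : ∑ j ∈ Finset.range N, (c j : ℂ) * z ^ j = 0 :=
  Finset.sum_eq_zero fun j hj => by simp [hlow j ((Finset.mem_range.1 hj).trans_le hN)]

lemma sum_range_mul_zero_pow {c : ℕ → ℝ} (hc : c 0 = 0) (N : ℕ) :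
    ∑ j ∈ Finset.range N, (c j : ℂ) * 0 ^ j = 0 :=
  Finset.sum_eq_zero fun j _ => by rcases eq_or_ne j 0 with rfl | hj <;> simp [*]

lemma isBigO_re_add_normSq {c : ℕ → ℝ} {f : ℂ → ℝ}
    (hTaylor : ∀ N : ℕ,
      (fun z : ℂ => f z - ∑ j ∈ Finset.range N, 2 * ((c j : ℂ) * z ^ j).re)
        =O[𝓝 0] fun z => z ^ N)
    {x w h : ℂ → ℂ} (hx : AnalyticAt ℂ x 0) (hx0 : x 0 = 0) {N : ℕ}
    (hO : (fun t => 2 * (w t).re + Complex.normSq (h t) + f (x t)) =O[𝓝 0] fun t : ℂ => t ^ N) :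
    (fun t => 2 * (w t + ∑ j ∈ Finset.range N, (c j : ℂ) * x t ^ j).re + Complex.normSq (h t))
      =O[𝓝 0] fun t : ℂ => t ^ N := by
  refine (hO.sub (taylor_comp_isBigO hTaylor hx hx0 N)).congr_left fun t => ?_
  rw [Complex.add_re]
  ring

lemma isBigO_normSq_pow {h : ℂ → ℂ} {k : ℕ} (hh : h =O[𝓝 0] fun t : ℂ => t ^ k) :
    (fun t => Complex.normSq (h t)) =O[𝓝 0] fun t : ℂ => t ^ (k * 2) := by
  simpa only [Complex.normSq_eq_norm_sq, ← pow_mul] using hh.norm_left.pow 2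

lemma isBigO_pow_of_isBigO_re_add_normSq {w h : ℂ → ℂ} (hw : AnalyticAt ℂ w 0) (hw0 : w 0 = 0)
    {n k : ℕ} (hh : h =O[𝓝 0] fun t : ℂ => t ^ k) (hnk : n ≤ k * 2)
    (hO : (fun t => 2 * (w t).re + Complex.normSq (h t)) =O[𝓝 0] fun t : ℂ => t ^ n) :
    w =O[𝓝 0] fun t : ℂ => t ^ n := by
  refine isBigO_pow_of_re_isBigO hw hw0 ?_
  refine ((hO.sub ((isBigO_normSq_pow hh).trans (isBigO_pow_pow_iff.2 hnk))).const_mul_left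
    (1 / 2 : ℝ)).congr_left fun t => ?_
  ring

lemma two_le_of_lt_nsmul {o : ℕ∞} {k : ℕ} (h : ((k + 1 : ℕ) : ℕ∞) ≤ k • o) : 2 ≤ o := by
  cases o with
  | top => exact le_top
  | coe o =>
    rw [nsmul_eq_mul] at h
    norm_cast at h ⊢
    by_contra! ho
    nlinarith

lemma two_le_analyticOrderAt_of_isBigO_pow {h : ℂ → ℂ} (hh : AnalyticAt ℂ h 0) {k : ℕ}
    (hO : (fun t => h t ^ k) =O[𝓝 0] fun t : ℂ => t ^ (k + 1)) : 2 ≤ analyticOrderAt h 0 := by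
  have h1 := (hh.pow k).isBigO_pow_iff.1 hO
  rw [analyticOrderAt_pow hh] at h1
  exact two_le_of_lt_nsmul h1

lemma deriv_eq_zero_of_isBigO_seven {x y w : ℂ → ℂ} (hx : AnalyticAt ℂ x 0)
    (hy : AnalyticAt ℂ y 0) (hw : AnalyticAt ℂ w 0) (hx0 : x 0 = 0) (hy0 : y 0 = 0) (hw0 : w 0 = 0)
    (hO : (fun t => 2 * (w t).re + Complex.normSq (x t ^ 3 - y t ^ 2))
      =O[𝓝 0] fun t : ℂ => t ^ 7) :
    deriv x 0 = 0 ∧ deriv y 0 = 0 ∧ deriv w 0 = 0 := by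
  have hh : AnalyticAt ℂ (fun t => x t ^ 3 - y t ^ 2) 0 := by fun_prop
  have hord : ∀ k < 4, analyticOrderAt (fun t => x t ^ 3 - y t ^ 2) 0 ≠ (k : ℕ) := fun k hk =>
    analyticOrderAt_ne_of_re_add_normSq_isBigO hw hw0 hh (by lia) hO
  have h4 : ((4 : ℕ) : ℕ∞) ≤ analyticOrderAt (fun t => x t ^ 3 - y t ^ 2) 0 := by
    cases hk : analyticOrderAt (fun t => x t ^ 3 - y t ^ 2) 0 with
    | top => exact le_top
    | coe k =>
      rw [Nat.cast_le]
      by_contra! hlt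
      exact hord k hlt hk
  have hhO := hh.isBigO_pow_iff.2 h4
  have hwO := hw.isBigO_pow_iff.1 (isBigO_pow_of_isBigO_re_add_normSq hw hw0 hhO (by norm_num) hO)
  have hy2 : 2 ≤ analyticOrderAt y 0 := two_le_analyticOrderAt_of_isBigO_pow hy (k := 2) <|
    (((hx.isBigO_id hx0).pow 3).sub (hhO.trans (isBigO_pow_pow_iff.2 (by norm_num)))).congr_left
      fun t => by ring
  have hyO : (fun t => y t ^ 2) =O[𝓝 0] fun t : ℂ => t ^ 4 := by
    simpa only [← pow_mul] using (hy.isBigO_pow_iff (n := 2).2 (by exact_mod_cast hy2)).pow 2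
  have hx2 : 2 ≤ analyticOrderAt x 0 := two_le_analyticOrderAt_of_isBigO_pow hx (k := 3) <|
    (hhO.add hyO).congr_left fun t => by ring
  exact ⟨deriv_eq_zero_of_two_le_analyticOrderAt hx hx0 hx2,
    deriv_eq_zero_of_two_le_analyticOrderAt hy hy0 hy2,
    deriv_eq_zero_of_two_le_analyticOrderAt hw hw0 (le_trans (by norm_num) hwO)⟩

lemma eventually_eq_zero_of_forall_isBigO_pow {h : ℂ → ℂ} (hh : AnalyticAt ℂ h 0)
    (hO : ∀ n : ℕ, h =O[𝓝 0] fun t : ℂ => t ^ n) : ∀ᶠ t in 𝓝 (0 : ℂ), h t = 0 := by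
  rw [← analyticOrderAt_eq_top, ENat.eq_top_iff_forall_ge]
  exact fun n => hh.isBigO_pow_iff.1 (hO n)

lemma eventually_eq_zero_of_infinite_tangency {c : ℕ → ℝ} (hc0 : c 0 = 0)
    (hrad0 : ∀ z : ℂ, z ≠ 0 → ¬ Summable fun j => (c j : ℂ) * z ^ j)
    {x y w : ℂ → ℂ} (hx : AnalyticAt ℂ x 0) (hy : AnalyticAt ℂ y 0) (hw : AnalyticAt ℂ w 0)
    (hx0 : x 0 = 0) (hw0 : w 0 = 0)
    (hO : ∀ N : ℕ, (fun t => 2 * (w t + ∑ j ∈ Finset.range N, (c j : ℂ) * x t ^ j).re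
      + Complex.normSq (x t ^ 3 - y t ^ 2)) =O[𝓝 0] fun t : ℂ => t ^ N) :
    ∀ᶠ t in 𝓝 (0 : ℂ), x t = 0 ∧ y t = 0 ∧ w t = 0 := by
  have hh : AnalyticAt ℂ (fun t => x t ^ 3 - y t ^ 2) 0 := by fun_prop
  have hW : ∀ N, AnalyticAt ℂ (fun t => w t + ∑ j ∈ Finset.range N, (c j : ℂ) * x t ^ j) 0 :=
    fun N => hw.add (Finset.analyticAt_fun_sum _ fun j _ => by fun_prop)
  have hW0 : ∀ N, w 0 + ∑ j ∈ Finset.range N, (c j : ℂ) * x 0 ^ j = 0 := fun N => by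
    rw [hw0, hx0, sum_range_mul_zero_pow hc0, add_zero]
  have htop : analyticOrderAt (fun t => x t ^ 3 - y t ^ 2) 0 = ⊤ := by
    cases hk : analyticOrderAt (fun t => x t ^ 3 - y t ^ 2) 0 with
    | top => rfl
    | coe k =>
      exact absurd hk (analyticOrderAt_ne_of_re_add_normSq_isBigO (hW (2 * k + 1))
        (hW0 _) hh (by lia) (hO _))
  have hWO : ∀ N, (fun t => w t + ∑ j ∈ Finset.range N, (c j : ℂ) * x t ^ j)
      =O[𝓝 0] fun t : ℂ => t ^ N := fun N =>
    isBigO_pow_of_isBigO_re_add_normSq (hW N) (hW0 N)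
      (hh.isBigO_pow_iff (n := N).2 (htop ▸ le_top)) (by lia) (hO N)
  by_cases hxz : ∀ᶠ t in 𝓝 (0 : ℂ), x t = 0
  · have hwz : ∀ᶠ t in 𝓝 (0 : ℂ), w t = 0 :=
      eventually_eq_zero_of_forall_isBigO_pow hw fun N =>
        (hWO N).congr' (hxz.mono fun t ht => by
          simp only [ht, sum_range_mul_zero_pow hc0, add_zero]) EventuallyEq.rfl
    filter_upwards [hxz, hwz, analyticOrderAt_eq_top.1 htop] with t h1 h2 h3
    exact ⟨h1, by simpa [h1] using h3, h2⟩
  · exfalso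
    obtain ⟨m, hm⟩ := ENat.ne_top_iff_exists.1 (mt analyticOrderAt_eq_top.1 hxz)
    have hxm := (hx.isTheta_pow_of_analyticOrderAt_eq hm.symm).2
    obtain ⟨B, K, hK, hBK⟩ := exists_norm_le_of_isBigO_pow (a := fun j => (c j : ℂ)) hx hw.neg hx0
      hxz fun k => by
      have h1 := (((hWO (max k (m * k))).trans
        (isBigO_pow_pow_iff.2 (le_max_right _ _))).congr_right fun t => pow_mul t m k).trans
        (hxm.pow k)
      have h2 := (sum_sub_sum_isBigO_pow c (le_max_left k (m * k))).comp_tendsto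
        (by simpa [hx0] using hx.continuousAt.tendsto : Tendsto x (𝓝 0) (𝓝 0))
      refine (h2.sub h1).congr_left fun t => ?_
      simp only [Function.comp_apply, Pi.neg_apply]
      ring
    obtain ⟨z, hz, hsum⟩ := exists_summable_of_norm_le hK hBK
    exact hrad0 z hz hsum

/-- Let `{c_j}_{j≥8}` be positive reals such that `∑ c_j z^j` has
radius of convergence `0`, let `f` be a smooth subharmonic function on `ℂ` with Taylor
series `2 ∑_{j≥8} Re (c_j z^j)`, and let `M ⊆ ℂ³` be defined by
`r = 2 Re w + |z₁³ − z₂²|² + f(z₁,z̄₁) = 0`.  Then `M` is pseudoconvex (its defining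
function is plurisubharmonic), `Δ₁(M,0) = ∞`, `Δ₁^reg(M,0) = 6 < ∞`, and yet no
nonconstant holomorphic curve is tangent to `M` at `0` to infinite order. -/
theorem statement17 (c : ℕ → ℝ)
    (hpos : ∀ j, 8 ≤ j → 0 < c j) (hlow : ∀ j < 8, c j = 0)
    (hrad0 : ∀ z : ℂ, z ≠ 0 → ¬ Summable fun j => (c j : ℂ) * z ^ j)
    (f : ℂ → ℝ) (hf : ContDiff ℝ (⊤ : ℕ∞) f)
    (hsub : Plurisubharmonic f)
    (hTaylor : ∀ N : ℕ,
      (fun z : ℂ => f z - ∑ j ∈ Finset.range N, 2 * ((c j : ℂ) * z ^ j).re)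
        =O[𝓝 0] fun z => z ^ N) :
    Plurisubharmonic
      (fun p : ℂ × ℂ × ℂ =>
        2 * p.2.2.re + Complex.normSq (p.1 ^ 3 - p.2.1 ^ 2) + f p.1) ∧
    DAngeloTypeInfinite
      (fun p : ℂ × ℂ × ℂ =>
        2 * p.2.2.re + Complex.normSq (p.1 ^ 3 - p.2.1 ^ 2) + f p.1) 0 ∧
    (∃ γ : ℂ → ℂ × ℂ × ℂ, AnalyticAt ℂ γ 0 ∧ γ 0 = 0 ∧ deriv γ 0 ≠ 0 ∧
      ordGE (fun t =>
        2 * (γ t).2.2.re + Complex.normSq ((γ t).1 ^ 3 - (γ t).2.1 ^ 2) + f (γ t).1) 6) ∧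
    (∀ γ : ℂ → ℂ × ℂ × ℂ, AnalyticAt ℂ γ 0 → γ 0 = 0 → deriv γ 0 ≠ 0 →
      ¬ ordGE (fun t =>
        2 * (γ t).2.2.re + Complex.normSq ((γ t).1 ^ 3 - (γ t).2.1 ^ 2) + f (γ t).1) 7) ∧
    ¬ ∃ γ : ℂ → ℂ × ℂ × ℂ, AnalyticAt ℂ γ 0 ∧ γ 0 = 0 ∧
        ¬ (∀ᶠ t in 𝓝 (0 : ℂ), γ t = 0) ∧
        ∀ N : ℕ, ordGE (fun t =>
          2 * (γ t).2.2.re + Complex.normSq ((γ t).1 ^ 3 - (γ t).2.1 ^ 2) + f (γ t).1) N := by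
  have hfc := hf.continuous
  have hc0 : c 0 = 0 := hlow 0 (by norm_num)
  refine ⟨?_, fun C => ?_, ?_, fun γ hγ hγ0 hγ' hO => ?_, ?_⟩
  · have h1 : Plurisubharmonic fun p : ℂ × ℂ × ℂ => 2 * p.2.2.re := by
      simpa using Differentiable.plurisubharmonic_re
        (show Differentiable ℂ fun p : ℂ × ℂ × ℂ => 2 * p.2.2 by fun_prop)
    have h2 : Plurisubharmonic fun p : ℂ × ℂ × ℂ => Complex.normSq (p.1 ^ 3 - p.2.1 ^ 2) :=
      Differentiable.plurisubharmonic_normSq (by fun_prop)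
    have hn : Continuous fun p : ℂ × ℂ × ℂ => Complex.normSq (p.1 ^ 3 - p.2.1 ^ 2) :=
      Complex.continuous_normSq.comp (by fun_prop)
    exact (h1.add h2 (by fun_prop) hn).add hsub.comp_fst ((by fun_prop : Continuous
      fun p : ℂ × ℂ × ℂ => 2 * p.2.2.re).add hn) (by fun_prop)
  · have hnot : ¬ ordGE (fun t : ℂ => (t ^ 2, t ^ 3,
        -∑ j ∈ Finset.range (C * 2), (c j : ℂ) * (t ^ 2) ^ j) - (0 : ℂ × ℂ × ℂ)) (2 + 1) := by
      intro h
      have := (isBigO_pow_pow_iff (m := 3) (n := 2)).1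
        ((isBigO_of_le _ fun t => by simp).trans h)
      lia
    refine ⟨fun t => (t ^ 2, t ^ 3, -∑ j ∈ Finset.range (C * 2), (c j : ℂ) * (t ^ 2) ^ j),
      ?_, ?_, fun h => hnot ?_, 2, one_le_two, hnot, ?_⟩
    · exact AnalyticAt.prod (by fun_prop) (AnalyticAt.prod (by fun_prop)
        (Finset.analyticAt_fun_sum _ fun j _ => by fun_prop).neg)
    · simp [-mul_eq_zero, sum_range_mul_zero_pow hc0]
    · exact (isBigO_zero _ _).congr' (h.mono fun t ht => (sub_eq_zero.2 ht).symm) EventuallyEq.rfl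
    · refine (taylor_comp_isBigO hTaylor (g := fun t => t ^ 2) (by fun_prop) (by simp)
        (C * 2)).congr_left fun t => ?_
      simp only [Complex.neg_re, ← pow_mul]
      norm_num
      ring
  · refine ⟨fun t => (t, 0, 0), by fun_prop, rfl, ?_, ?_⟩
    · rw [((hasDerivAt_id' (0 : ℂ)).prodMk ((hasDerivAt_const 0 (0 : ℂ)).prodMk
        (hasDerivAt_const 0 (0 : ℂ)))).deriv]
      simp
    · have h1 := taylor_comp_isBigO hTaylor analyticAt_id rfl 6
      have h2 := isBigO_normSq_pow (isBigO_refl (fun t : ℂ => t ^ 3) (𝓝 0))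
      refine (h2.add h1).congr_left fun t => ?_
      simp [sum_range_eq_zero_of_forall_lt hlow]
  · have hx : AnalyticAt ℂ (fun t => (γ t).1) 0 := analyticAt_fst.comp hγ
    have hy : AnalyticAt ℂ (fun t => (γ t).2.1) 0 :=
      analyticAt_fst.comp (analyticAt_snd.comp hγ)
    have hw : AnalyticAt ℂ (fun t => (γ t).2.2) 0 :=
      analyticAt_snd.comp (analyticAt_snd.comp hγ)
    have h := isBigO_re_add_normSq hTaylor hx (by simp [hγ0]) hO
    simp only [sum_range_eq_zero_of_forall_lt hlow (show 7 ≤ 8 by norm_num), add_zero] at h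
    obtain ⟨h1, h2, h3⟩ := deriv_eq_zero_of_isBigO_seven hx hy hw (by simp [hγ0]) (by simp [hγ0])
      (by simp [hγ0]) h
    apply hγ'
    rw [(hx.differentiableAt.hasDerivAt.prodMk (hy.differentiableAt.hasDerivAt.prodMk
      hw.differentiableAt.hasDerivAt)).deriv, h1, h2, h3]
    rfl
  · rintro ⟨γ, hγ, hγ0, hγne, hO⟩
    have hx : AnalyticAt ℂ (fun t => (γ t).1) 0 := analyticAt_fst.comp hγ
    have hy : AnalyticAt ℂ (fun t => (γ t).2.1) 0 :=
      analyticAt_fst.comp (analyticAt_snd.comp hγ)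
    have hw : AnalyticAt ℂ (fun t => (γ t).2.2) 0 :=
      analyticAt_snd.comp (analyticAt_snd.comp hγ)
    refine hγne ((eventually_eq_zero_of_infinite_tangency hc0 hrad0 hx hy hw (by simp [hγ0])
      (by simp [hγ0]) fun N => isBigO_re_add_normSq hTaylor hx (by simp [hγ0]) (hO N)).mono ?_)
    rintro t ⟨h1, h2, h3⟩
    exact Prod.ext h1 (Prod.ext h2 h3)
end

section
/- Let F(z,z̄) be a smooth real-valued function near 0 in ℂ with ord(F) = m < ∞, r(z,w) = 2Re(w) + F(z,z̄) + R₁·Im(w) + R₂ a defining function of a hypersurface M ⊂ ℂ² in a standard coordinate. Then the Newton polyhedron of r is N₊(r) = {ξ ∈ ℝ₊² : ξ₁/m + ξ₂ ≥ 1}, and any holomorphic curve tangent to M at 0 to infinite order with first component t must have the form γ(t) = (t, c t^m + O(t^{m+1})) for some c ≠ 0, provided the facet {ξ₁/m + ξ₂ = 1}-part of r is N-degenerate. -/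
open Topology Asymptotics Filter

/-- The Newton polyhedron (in `ℝ²`) associated to a set `S ⊆ ℤ₊²` of exponents. -/
def NewtonPolyhedron2 (S : Set (ℕ × ℕ)) : Set (ℝ × ℝ) :=
  convexHull ℝ (⋃ γ ∈ S, {ξ : ℝ × ℝ | (γ.1 : ℝ) ≤ ξ.1 ∧ (γ.2 : ℝ) ≤ ξ.2})

theorem isBigO_norm_pow_of_le {E : Type*} [SeminormedAddCommGroup E] {m n : ℕ} (h : m ≤ n) :
    (fun z : E => ‖z‖ ^ n) =O[𝓝 0] fun z => ‖z‖ ^ m := by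
  refine IsBigO.of_bound 1 ?_
  filter_upwards [Metric.ball_mem_nhds (0 : E) one_pos] with z hz
  have : ‖z‖ < 1 := by simpa using hz
  simpa using pow_le_pow_of_le_one (norm_nonneg z) this.le h

section Derivatives

variable {E G : Type*} [NormedAddCommGroup E] [NormedSpace ℝ E]
  [NormedAddCommGroup G] [NormedSpace ℝ G]

theorem iteratedFDeriv_succ_apply_eq_fderiv {f : E → G} (hf : ContDiff ℝ (⊤ : ℕ∞) f) (n : ℕ) (x : E)
    (v : Fin (n + 1) → E) :
    iteratedFDeriv ℝ (n + 1) f x v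
      = fderiv ℝ (fun y => iteratedFDeriv ℝ n f y (Fin.tail v)) x (v 0) := by
  have hd : DifferentiableAt ℝ (iteratedFDeriv ℝ n f) x :=
    (hf.differentiable_iteratedFDeriv (by exact_mod_cast ENat.natCast_lt_top n)).differentiableAt
  exact DifferentiableAt.iteratedFDeriv_succ_apply_left' hd

theorem ContDiff.iteratedFDeriv_apply_const {f : E → G} (hf : ContDiff ℝ (⊤ : ℕ∞) f) (n : ℕ)
    (u : Fin n → E) : ContDiff ℝ (⊤ : ℕ∞) fun y => iteratedFDeriv ℝ n f y u :=
  (ContinuousMultilinearMap.apply ℝ (fun _ : Fin n => E) G u).contDiff.comp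
    (hf.iteratedFDeriv_right (by exact_mod_cast le_top))

theorem iteratedFDeriv_comp_swap_castSucc_succ {f : E → G} (hf : ContDiff ℝ (⊤ : ℕ∞) f) {n : ℕ}
    (i : Fin n) (x : E) (v : Fin (n + 1) → E) :
    iteratedFDeriv ℝ (n + 1) f x (v ∘ Equiv.swap i.castSucc i.succ)
      = iteratedFDeriv ℝ (n + 1) f x v := by
  induction n generalizing x with
  | zero => exact i.elim0
  | succ n ih =>
    refine Fin.cases ?_ (fun j => ?_) i
    · have key : ∀ w : Fin (n + 1 + 1) → E, iteratedFDeriv ℝ (n + 1 + 1) f x w =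
          fderiv ℝ (fderiv ℝ fun y => iteratedFDeriv ℝ n f y (Fin.tail (Fin.tail w))) x
            (w 0) (w 1) := by
        intro w
        have hg := hf.iteratedFDeriv_apply_const n (Fin.tail (Fin.tail w))
        rw [iteratedFDeriv_succ_apply_eq_fderiv hf]
        simp_rw [iteratedFDeriv_succ_apply_eq_fderiv hf n]
        have hd : DifferentiableAt ℝ
            (fderiv ℝ fun y => iteratedFDeriv ℝ n f y (Fin.tail (Fin.tail w))) x :=
          ((hg.fderiv_right (m := 1) (by norm_cast)).differentiable (by simp)).differentiableAt
        rw [fderiv_clm_apply hd (by fun_prop)]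
        simp [Fin.tail]
      rw [key, key]
      have htail : Fin.tail (Fin.tail (v ∘ Equiv.swap (0 : Fin (n + 1)).castSucc
          (0 : Fin (n + 1)).succ)) = Fin.tail (Fin.tail v) := by
        funext k
        simp only [Fin.tail, Function.comp]
        rw [Equiv.swap_apply_of_ne_of_ne] <;> simp [Fin.ext_iff]
      rw [htail]
      have hg := hf.iteratedFDeriv_apply_const n (Fin.tail (Fin.tail v))
      have hs : IsSymmSndFDerivAt ℝ
          (fun y => iteratedFDeriv ℝ n f y (Fin.tail (Fin.tail v))) x :=
        hg.contDiffAt.isSymmSndFDerivAt (by simp; norm_cast)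
      simpa using hs.eq (v 1) (v 0)
    · rw [iteratedFDeriv_succ_apply_eq_fderiv hf, iteratedFDeriv_succ_apply_eq_fderiv hf]
      have htail : Fin.tail (v ∘ Equiv.swap j.succ.castSucc j.succ.succ)
          = Fin.tail v ∘ Equiv.swap j.castSucc j.succ := by
        funext k
        simp only [Fin.tail, Function.comp, ← Fin.succ_castSucc]
        rw [(Fin.succ_injective _).swap_apply]
      have h0 : (v ∘ Equiv.swap j.succ.castSucc j.succ.succ) 0 = v 0 := by
        simp only [Function.comp]
        rw [Equiv.swap_apply_of_ne_of_ne] <;> simp [Fin.ext_iff]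
      rw [htail, h0]
      simp_rw [ih j]

theorem iteratedFDeriv_comp_perm_of_smooth {f : E → G} (hf : ContDiff ℝ (⊤ : ℕ∞) f) {n : ℕ}
    (x : E) (v : Fin n → E) (σ : Equiv.Perm (Fin n)) :
    iteratedFDeriv ℝ n f x (v ∘ σ) = iteratedFDeriv ℝ n f x v := by
  cases n with
  | zero => congr 1; exact Subsingleton.elim _ _
  | succ n =>
    have hσ : σ ∈ Submonoid.closure
        (Set.range fun i : Fin n => Equiv.swap i.castSucc i.succ) := by
      rw [Equiv.Perm.mclosure_swap_castSucc_succ]; trivial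
    induction hσ using Submonoid.closure_induction generalizing v with
    | mem τ h =>
      obtain ⟨i, rfl⟩ := h
      exact iteratedFDeriv_comp_swap_castSucc_succ hf i x v
    | one => rfl
    | mul τ ρ _ _ h₁ h₂ =>
      rw [Equiv.Perm.coe_mul, ← Function.comp_assoc, h₂, h₁]

theorem iteratedFDeriv_eq_zero_of_diagonal {f : E → G} (hf : ContDiff ℝ (⊤ : ℕ∞) f) {n : ℕ} {x : E}
    (h : ∀ y, iteratedFDeriv ℝ n f x (fun _ => y) = 0) : iteratedFDeriv ℝ n f x = 0 := by
  ext v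
  have hsum := (iteratedFDeriv ℝ n f x).iteratedFDeriv_comp_diagonal 0 v
  simp_rw [h] at hsum
  have hc : ∀ σ : Equiv.Perm (Fin n), iteratedFDeriv ℝ n f x (fun i => v (σ i))
      = iteratedFDeriv ℝ n f x v := fun σ => iteratedFDeriv_comp_perm_of_smooth hf x v σ
  simp_rw [hc] at hsum
  have hz : iteratedFDeriv ℝ n (fun _ : E => (0 : G)) 0 = 0 := by
    simp
  rw [hz] at hsum
  rw [Finset.sum_const, ← Nat.cast_smul_eq_nsmul ℝ] at hsum
  have hsum' := hsum.symm
  simp only [zero_apply, smul_eq_zero] at hsum'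
  rcases hsum' with h' | h'
  · simp [Fintype.card_perm, Nat.factorial_ne_zero] at h'
  · simpa using h'

theorem isBigO_sub_iteratedFDeriv_diagonal [CompleteSpace G] {f : E → G}
    (hf : ContDiff ℝ (⊤ : ℕ∞) f) {n : ℕ} (hlow : ∀ k < n, iteratedFDeriv ℝ k f 0 = 0) :
    (fun y => f y - (n.factorial : ℝ)⁻¹ • iteratedFDeriv ℝ n f 0 (fun _ => y))
      =O[𝓝 0] fun y => ‖y‖ ^ (n + 1) := by
  have hcont : Continuous (iteratedFDeriv ℝ (n + 1) f) :=
    hf.continuous_iteratedFDeriv (by exact_mod_cast le_top)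
  set M := ‖iteratedFDeriv ℝ (n + 1) f 0‖ + 1
  have hM : ∀ᶠ y in 𝓝 (0 : E), ‖iteratedFDeriv ℝ (n + 1) f y‖ < M :=
    hcont.norm.continuousAt.eventually_lt_const (lt_add_one _)
  obtain ⟨δ, hδ, hball⟩ := Metric.eventually_nhds_iff.1 hM
  refine IsBigO.of_bound ((n.factorial : ℝ)⁻¹ * M) ?_
  filter_upwards [Metric.ball_mem_nhds (0 : E) hδ] with y hy
  have ht := map_add_eq_sum_add_integral_iteratedFDeriv (f := f) (x := 0) (y := y) (n := n)
    (fun t _ => (hf.of_le (by exact_mod_cast le_top)).contDiffAt)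
  rw [Finset.sum_range_succ, Finset.sum_eq_zero (fun k hk => by
    rw [hlow k (Finset.mem_range.1 hk)]; simp), zero_add, zero_add] at ht
  rw [ht, add_sub_cancel_left, norm_smul, norm_inv, RCLike.norm_natCast, mul_assoc]
  gcongr
  have hb := intervalIntegral.norm_integral_le_of_norm_le_const (a := 0) (b := 1)
    (C := M * ‖y‖ ^ (n + 1))
    (f := fun t : ℝ => (1 - t) ^ n • iteratedFDeriv ℝ (n + 1) f (0 + t • y) fun _ => y) ?_
  · simpa using hb
  · intro t ht
    rw [Set.uIoc_of_le zero_le_one] at ht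
    have hin : dist (0 + t • y) 0 < δ := by
      rw [zero_add, dist_zero_right, norm_smul, Real.norm_of_nonneg ht.1.le]
      have : ‖y‖ < δ := by simpa using hy
      nlinarith [ht.2, norm_nonneg y]
    have h1 : ‖(1 - t) ^ n‖ ≤ 1 := by
      rw [norm_pow, Real.norm_of_nonneg (by linarith [ht.2])]
      exact pow_le_one₀ (by linarith [ht.2]) (by linarith [ht.1])
    have h2 : ‖iteratedFDeriv ℝ (n + 1) f (0 + t • y) fun _ => y‖ ≤ M * ‖y‖ ^ (n + 1) := by
      refine (ContinuousMultilinearMap.le_opNorm _ _).trans ?_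
      simp only [Finset.prod_const, Finset.card_univ, Fintype.card_fin]
      gcongr
      exact (hball hin).le
    rw [norm_smul]
    calc _ ≤ 1 * _ := mul_le_mul h1 h2 (norm_nonneg _) zero_le_one
      _ = _ := one_mul _

theorem eq_zero_of_homogeneous_isBigO {f : E → G} {k : ℕ}
    (hom : ∀ (s : ℝ) (z : E), 0 < s → f (s • z) = s ^ k • f z)
    (hO : f =O[𝓝 0] fun z => ‖z‖ ^ (k + 1)) (z : E) : f z = 0 := by
  have hs : Tendsto (fun s : ℝ => s • z) (𝓝[>] 0) (𝓝 0) := by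
    have : Tendsto (fun s : ℝ => s • z) (𝓝 0) (𝓝 ((0 : ℝ) • z)) :=
      (continuous_id.smul continuous_const).tendsto 0
    rw [zero_smul] at this
    exact this.mono_left nhdsWithin_le_nhds
  obtain ⟨B, hB⟩ := (hO.comp_tendsto hs).bound
  have hle : ∀ᶠ s : ℝ in 𝓝[>] 0, ‖f z‖ ≤ s * (B * ‖z‖ ^ (k + 1)) := by
    filter_upwards [hB, self_mem_nhdsWithin] with s h1 (h2 : 0 < s)
    simp only [Function.comp, hom s z h2, norm_smul, norm_pow, norm_mul, norm_norm,
      Real.norm_of_nonneg h2.le] at h1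
    have : s ^ k * ‖f z‖ ≤ s ^ k * (s * (B * ‖z‖ ^ (k + 1))) := by
      calc _ ≤ _ := h1
        _ = _ := by ring
    exact le_of_mul_le_mul_left this (pow_pos h2 k)
  have hlim : Tendsto (fun s : ℝ => s * (B * ‖z‖ ^ (k + 1))) (𝓝[>] 0) (𝓝 0) := by
    have : Tendsto (fun s : ℝ => s * (B * ‖z‖ ^ (k + 1))) (𝓝 0) (𝓝 (0 * (B * ‖z‖ ^ (k + 1)))) :=
      (continuous_id.mul continuous_const).tendsto 0
    rw [zero_mul] at this
    exact this.mono_left nhdsWithin_le_nhds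
  exact norm_le_zero_iff.1 (ge_of_tendsto hlim hle)

theorem isBigO_of_iteratedFDeriv_eq_zero [CompleteSpace G] {f : E → G}
    (hf : ContDiff ℝ (⊤ : ℕ∞) f) {n : ℕ} (hlow : ∀ k < n, iteratedFDeriv ℝ k f 0 = 0) :
    f =O[𝓝 0] fun y => ‖y‖ ^ n := by
  have h1 := (isBigO_sub_iteratedFDeriv_diagonal hf hlow).trans (isBigO_norm_pow_of_le n.le_succ)
  have h2 : (fun y => (n.factorial : ℝ)⁻¹ • iteratedFDeriv ℝ n f 0 (fun _ => y))
      =O[𝓝 0] fun y => ‖y‖ ^ n := by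
    refine IsBigO.const_smul_left (IsBigO.of_bound ‖iteratedFDeriv ℝ n f 0‖ ?_) _
    filter_upwards with y
    simpa using (iteratedFDeriv ℝ n f 0).le_opNorm fun _ => y
  simpa using h1.add h2

theorem iteratedFDeriv_eq_zero_of_isBigO [CompleteSpace G] {f : E → G}
    (hf : ContDiff ℝ (⊤ : ℕ∞) f) {n : ℕ} (hlow : ∀ k < n, iteratedFDeriv ℝ k f 0 = 0)
    (hO : f =O[𝓝 0] fun y => ‖y‖ ^ (n + 1)) : iteratedFDeriv ℝ n f 0 = 0 := by
  have h1 := hO.sub (isBigO_sub_iteratedFDeriv_diagonal hf hlow)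
  simp only [sub_sub_cancel] at h1
  refine iteratedFDeriv_eq_zero_of_diagonal hf fun y => ?_
  have := eq_zero_of_homogeneous_isBigO (k := n) ?_ h1 y
  · simpa [Nat.factorial_ne_zero] using this
  · intro s z _
    have := (iteratedFDeriv ℝ n f 0).map_smul_univ (fun _ => s) (fun _ => z)
    rw [this]
    rw [Finset.prod_const, Finset.card_univ, Fintype.card_fin, smul_comm]

end Derivatives

/-- The homogeneous part of degree `k` of the formal series `∑ d a b z ^ a * conj z ^ b`. -/
noncomputable def homogeneousPart (d : ℕ → ℕ → ℂ) (k : ℕ) (z : ℂ) : ℂ :=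
  ∑ p ∈ Finset.HasAntidiagonal.antidiagonal k, d p.1 p.2 * z ^ p.1 * (starRingEnd ℂ) z ^ p.2

theorem homogeneousPart_smul (d : ℕ → ℕ → ℂ) (k : ℕ) (s : ℝ) (z : ℂ) :
    homogeneousPart d k (s • z) = s ^ k • homogeneousPart d k z := by
  simp only [homogeneousPart, Finset.smul_sum, Complex.real_smul, map_mul, Complex.conj_ofReal]
  refine Finset.sum_congr rfl fun p hp => ?_
  rw [← Finset.HasAntidiagonal.mem_antidiagonal.1 hp]
  push_cast
  ring

theorem homogeneousPart_isBigO (d : ℕ → ℕ → ℂ) (k : ℕ) :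
    homogeneousPart d k =O[𝓝 0] fun z => ‖z‖ ^ k := by
  unfold homogeneousPart
  refine IsBigO.fun_sum fun p hp =>
    IsBigO.of_bound ‖d p.1 p.2‖ (Eventually.of_forall fun z => ?_)
  rw [← Finset.HasAntidiagonal.mem_antidiagonal.1 hp]
  simp [pow_add, mul_assoc]

theorem coeff_eq_zero_of_homogeneousPart_eq_zero {d : ℕ → ℕ → ℂ} {k : ℕ}
    (h : ∀ z, homogeneousPart d k z = 0) {a b : ℕ} (hab : a + b = k) : d a b = 0 := by
  let p : Polynomial ℂ := ∑ q ∈ Finset.HasAntidiagonal.antidiagonal k,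
    Polynomial.monomial (2 * q.1) (d q.1 q.2)
  have hroot : ∀ u : Circle, p.eval (u : ℂ) = 0 := by
    intro u
    have hu : (u : ℂ) * (starRingEnd ℂ) u = 1 := by simp [Complex.mul_conj]
    have : p.eval (u : ℂ) = (u : ℂ) ^ k * homogeneousPart d k u := by
      simp only [p, Polynomial.eval_finsetSum, Polynomial.eval_monomial, homogeneousPart,
        Finset.mul_sum]
      refine Finset.sum_congr rfl fun q hq => ?_
      rw [← Finset.HasAntidiagonal.mem_antidiagonal.1 hq]
      calc d q.1 q.2 * (u : ℂ) ^ (2 * q.1)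
          = d q.1 q.2 * (u : ℂ) ^ (2 * q.1) * ((u : ℂ) * (starRingEnd ℂ) u) ^ q.2 := by
            rw [hu]; simp
        _ = _ := by ring
    rw [this, h, mul_zero]
  have : Infinite Circle := by
    have := Set.Ioc.infinite (neg_lt_self Real.pi_pos)
    exact Infinite.of_injective _ Circle.argEquiv.symm.injective
  have hp : p = 0 := by
    refine Polynomial.eq_zero_of_infinite_isRoot p (Set.Infinite.mono (s := Set.range
      fun u : Circle => (u : ℂ)) ?_ (Set.infinite_range_of_injective Circle.coe_injective))
    rintro _ ⟨u, rfl⟩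
    exact hroot u
  have hc : p.coeff (2 * a) = d a b := by
    simp only [p, Polynomial.finsetSum_coeff, Polynomial.coeff_monomial]
    rw [Finset.sum_eq_single (a, b)]
    · simp
    · rintro ⟨a', b'⟩ hq hne
      rw [if_neg]
      rintro he
      apply hne
      have := Finset.HasAntidiagonal.mem_antidiagonal.1 hq
      simp only at this he
      ext <;> simp <;> omega
    · intro hn
      exact absurd (Finset.HasAntidiagonal.mem_antidiagonal.2 hab) hn
  rw [← hc, hp, Polynomial.coeff_zero]

theorem coeff_eq_zero_of_sum_homogeneousPart_isBigO {d : ℕ → ℕ → ℂ} {N : ℕ}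
    (hO : (fun z => ∑ k ∈ Finset.range N, homogeneousPart d k z) =O[𝓝 0] fun z => ‖z‖ ^ N)
    {a b : ℕ} (hab : a + b < N) : d a b = 0 := by
  suffices h : ∀ k < N, ∀ z, homogeneousPart d k z = 0 from
    coeff_eq_zero_of_homogeneousPart_eq_zero (h _ hab) rfl
  intro k
  induction k using Nat.strong_induction_on with
  | _ k ih =>
    intro hk
    refine eq_zero_of_homogeneous_isBigO (fun s z _ => homogeneousPart_smul d k s z) ?_
    have hrest : (fun z => ∑ j ∈ (Finset.range N).erase k, homogeneousPart d j z)
        =O[𝓝 0] fun z => ‖z‖ ^ (k + 1) := by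
      refine IsBigO.fun_sum fun j hj => ?_
      rw [Finset.mem_erase, Finset.mem_range] at hj
      rcases lt_or_gt_of_ne hj.1 with hlt | hgt
      · have : homogeneousPart d j = fun _ => 0 := funext (ih j hlt hj.2)
        rw [this]
        exact isBigO_zero _ _
      · exact (homogeneousPart_isBigO d j).trans (isBigO_norm_pow_of_le (E := ℂ) hgt)
    refine ((hO.trans (isBigO_norm_pow_of_le hk)).sub hrest).congr_left fun z => ?_
    rw [← Finset.add_sum_erase _ _ (Finset.mem_range.2 hk), add_sub_cancel_right]

theorem sum_range_product_eq_sum_homogeneousPart (d : ℕ → ℕ → ℂ) (N : ℕ) (z : ℂ) :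
    (∑ a ∈ Finset.range N, ∑ b ∈ Finset.range N,
      if a + b < N then d a b * z ^ a * (starRingEnd ℂ) z ^ b else 0)
      = ∑ k ∈ Finset.range N, homogeneousPart d k z := by
  rw [← Finset.sum_product', ← Finset.sum_filter,
    ← Finset.sum_fiberwise_of_maps_to (t := Finset.range N) (g := fun p : ℕ × ℕ => p.1 + p.2)
      (fun p hp => Finset.mem_range.2 (Finset.mem_filter.1 hp).2)]
  refine Finset.sum_congr rfl fun k hk => Finset.sum_congr ?_ fun _ _ => rfl
  ext ⟨a, b⟩
  simp only [Finset.mem_range, Finset.mem_filter, Finset.mem_product,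
    Finset.HasAntidiagonal.mem_antidiagonal] at *
  omega

theorem sum_bidegree_eq_sum_homogeneousPart (c : ℕ × ℕ → ℕ × ℕ → ℂ) {N : ℕ} (hN : 0 < N) (z : ℂ) :
    (∑ α ∈ Finset.range N ×ˢ Finset.range N, ∑ β ∈ Finset.range N ×ˢ Finset.range N,
      if α.1 + α.2 + β.1 + β.2 < N then
        c α β * z ^ α.1 * (0 : ℂ) ^ α.2 *
          (starRingEnd ℂ) z ^ β.1 * (starRingEnd ℂ) (0 : ℂ) ^ β.2
      else 0)
      = ∑ k ∈ Finset.range N, homogeneousPart (fun a b => c (a, 0) (b, 0)) k z := by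
  rw [← sum_range_product_eq_sum_homogeneousPart, Finset.sum_product]
  refine Finset.sum_congr rfl fun a _ => ?_
  rw [Finset.sum_eq_single 0, Finset.sum_product]
  · refine Finset.sum_congr rfl fun b _ => ?_
    rw [Finset.sum_eq_single 0]
    · simp
    · intro j _ hj
      simp [hj]
    · intro h
      exact absurd (Finset.mem_range.2 hN) h
  · intro j _ hj
    simp [hj]
  · intro h
    exact absurd (Finset.mem_range.2 hN) h

theorem eq_zero_of_forall_re_mul_pow_eq_zero {b : ℂ} {n : ℕ} (hn : 0 < n)
    (h : ∀ t : ℂ, (b * t ^ n).re = 0) : b = 0 := by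
  obtain ⟨t, ht⟩ := IsAlgClosed.exists_pow_nat_eq ((starRingEnd ℂ) b) hn
  have := h t
  rw [ht, Complex.mul_conj, Complex.ofReal_re] at this
  exact Complex.normSq_eq_zero.1 this

theorem eq_zero_of_re_mul_pow_isBigO {b : ℂ} {n : ℕ} (hn : 0 < n)
    (h : (fun t : ℂ => 2 * (b * t ^ n).re) =O[𝓝 0] fun t => ‖t‖ ^ (n + 1)) : b = 0 := by
  refine eq_zero_of_forall_re_mul_pow_eq_zero hn fun t => ?_
  have := eq_zero_of_homogeneous_isBigO (k := n) (fun s z _ => ?_) h t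
  · linarith
  · have : b * (s • z) ^ n = ((s ^ n : ℝ) : ℂ) * (b * z ^ n) := by
      simp only [Complex.real_smul]; push_cast; ring
    rw [this, Complex.re_ofReal_mul, smul_eq_mul]
    ring

theorem AnalyticAt.exists_eq_add_mul {g : ℂ → ℂ} (hg : AnalyticAt ℂ g 0) :
    ∃ h : ℂ → ℂ, AnalyticAt ℂ h 0 ∧ ∀ t, g t = g 0 + t * h t := by
  obtain ⟨p, hp⟩ := hg
  refine ⟨dslope g 0, hp.has_fpower_series_dslope_fslope.analyticAt, fun t => ?_⟩
  have := sub_smul_dslope g 0 t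
  rw [sub_zero, smul_eq_mul] at this
  rw [this]
  ring

theorem newtonPolyhedron2_eq {m : ℕ} (hm : 1 ≤ m) {S : Set (ℕ × ℕ)} (h1 : (m, 0) ∈ S)
    (h2 : (0, 1) ∈ S) (hS : ∀ ξ ∈ S, ξ.2 = 0 → m ≤ ξ.1) :
    NewtonPolyhedron2 S = {ξ : ℝ × ℝ | 0 ≤ ξ.1 ∧ 0 ≤ ξ.2 ∧ 1 ≤ ξ.1 / m + ξ.2} := by
  have hm0 : (0 : ℝ) < m := by exact_mod_cast hm
  apply Set.Subset.antisymm
  · refine convexHull_min ?_ ?_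
    · refine Set.iUnion₂_subset fun γ hγ ξ hξ => ?_
      obtain ⟨ha, hb⟩ := hξ
      have hx : 0 ≤ ξ.1 := (Nat.cast_nonneg _).trans ha
      have hy : 0 ≤ ξ.2 := (Nat.cast_nonneg _).trans hb
      refine ⟨hx, hy, ?_⟩
      rcases Nat.eq_zero_or_pos γ.2 with h | h
      · have : (m : ℝ) ≤ γ.1 := by exact_mod_cast hS γ hγ h
        have : 1 ≤ ξ.1 / m := by rw [le_div_iff₀ hm0]; linarith
        linarith
      · have : (1 : ℝ) ≤ γ.2 := by exact_mod_cast h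
        have := div_nonneg hx hm0.le
        linarith
    · intro x hx y hy a b ha hb hab
      obtain ⟨hx1, hx2, hx3⟩ := hx
      obtain ⟨hy1, hy2, hy3⟩ := hy
      refine ⟨?_, ?_, ?_⟩
      · simp only [Prod.fst_add, Prod.smul_fst, smul_eq_mul]; positivity
      · simp only [Prod.snd_add, Prod.smul_snd, smul_eq_mul]; positivity
      · simp only [Prod.fst_add, Prod.smul_fst, Prod.snd_add, Prod.smul_snd, smul_eq_mul]
        calc (1 : ℝ) = a * 1 + b * 1 := by linarith
          _ ≤ a * (x.1 / m + x.2) + b * (y.1 / m + y.2) := by gcongr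
          _ = _ := by ring
  · rintro ⟨x, y⟩ ⟨hx, hy, hxy⟩
    simp only at hx hy hxy
    have mem : ∀ γ ∈ S, ∀ ξ : ℝ × ℝ, (γ.1 : ℝ) ≤ ξ.1 → (γ.2 : ℝ) ≤ ξ.2 → ξ ∈ NewtonPolyhedron2 S :=
      fun γ hγ ξ ha hb => subset_convexHull ℝ _ (Set.mem_iUnion₂.2 ⟨γ, hγ, ha, hb⟩)
    rcases le_or_gt 1 y with hy1 | hy1
    · exact mem _ h2 _ (by simpa using hx) (by simpa using hy1)
    · have hpos : 0 < 1 - y := by linarith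
      have hA := mem _ h1 (x / (1 - y), 0) (by
        rw [le_div_iff₀ hpos, mul_comm, ← le_div_iff₀ hm0]
        linarith) (by simp)
      have hB := mem _ h2 (0, 1) (by simp) (by simp)
      have := (convex_convexHull ℝ _) hA hB hpos.le hy (by ring)
      have he : (x, y) = (1 - y) • (x / (1 - y), (0 : ℝ)) + y • ((0 : ℝ), (1 : ℝ)) := by
        simp [mul_div_cancel₀ x hpos.ne']
      rw [he]
      exact this

theorem taylor_first_variable {F R₁ : ℂ → ℝ} {R₂ : ℂ × ℂ → ℝ} {c : ℕ × ℕ → ℕ × ℕ → ℂ} {N : ℕ}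
    (hN : 0 < N) (hR₂ : ∀ᶠ z in 𝓝 (0 : ℂ), R₂ (z, 0) = 0)
    (hTaylor : (fun q : ℂ × ℂ =>
        ((2 * q.2.re + F q.1 + R₁ q.1 * q.2.im + R₂ q : ℝ) : ℂ) -
        ∑ α ∈ Finset.range N ×ˢ Finset.range N,
          ∑ β ∈ Finset.range N ×ˢ Finset.range N,
            if α.1 + α.2 + β.1 + β.2 < N then
              c α β * q.1 ^ α.1 * q.2 ^ α.2 *
                (starRingEnd ℂ) q.1 ^ β.1 * (starRingEnd ℂ) q.2 ^ β.2
            else 0)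
        =O[𝓝 0] fun q => ‖q‖ ^ N) :
    (fun z => (F z : ℂ) - ∑ k ∈ Finset.range N, homogeneousPart (fun a b => c (a, 0) (b, 0)) k z)
      =O[𝓝 0] fun z => ‖z‖ ^ N := by
  have ht : Tendsto (fun z : ℂ => (z, (0 : ℂ))) (𝓝 0) (𝓝 0) :=
    (Continuous.prodMk_left (0 : ℂ)).tendsto 0
  refine (hTaylor.comp_tendsto ht).congr' ?_ (Eventually.of_forall fun z => by simp [Prod.norm_def])
  filter_upwards [hR₂] with z hz
  simp only [Function.comp]
  rw [sum_bidegree_eq_sum_homogeneousPart c hN, hz]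
  simp

theorem taylor_linear_coeff_second_variable {F R₁ : ℂ → ℝ} {R₂ : ℂ × ℂ → ℝ} {C : ℝ}
    {c : ℕ × ℕ → ℕ × ℕ → ℂ}
    (hF0 : F 0 = 0) (hR₁0 : R₁ 0 = 0)
    (hR₂ : ∀ᶠ q in 𝓝 (0 : ℂ × ℂ), |R₂ q| ≤ C * q.2.im ^ 2)
    (hTaylor : (fun q : ℂ × ℂ =>
        ((2 * q.2.re + F q.1 + R₁ q.1 * q.2.im + R₂ q : ℝ) : ℂ) -
        ∑ α ∈ Finset.range 2 ×ˢ Finset.range 2,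
          ∑ β ∈ Finset.range 2 ×ˢ Finset.range 2,
            if α.1 + α.2 + β.1 + β.2 < 2 then
              c α β * q.1 ^ α.1 * q.2 ^ α.2 *
                (starRingEnd ℂ) q.1 ^ β.1 * (starRingEnd ℂ) q.2 ^ β.2
            else 0)
        =O[𝓝 0] fun q => ‖q‖ ^ 2) :
    c (0, 1) (0, 0) = 1 ∧ c (0, 0) (0, 1) = 1 := by
  have ht : Tendsto (fun w : ℂ => ((0 : ℂ), w)) (𝓝 0) (𝓝 0) :=
    (Continuous.prodMk_right (0 : ℂ)).tendsto 0
  have hR : (fun w : ℂ => (R₂ (0, w) : ℂ)) =O[𝓝 0] fun w => ‖w‖ ^ 2 := by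
    refine Complex.isBigO_ofReal_left.2 (IsBigO.of_bound |C| ?_)
    filter_upwards [ht.eventually hR₂] with w hw
    rw [Real.norm_eq_abs, norm_pow, norm_norm]
    refine hw.trans ?_
    rw [← sq_abs w.im]
    gcongr
    · exact le_abs_self C
    · exact Complex.abs_im_le_norm w
  let d : ℕ → ℕ → ℂ := fun a b => c (0, a) (0, b) - if a + b = 1 then 1 else 0
  have hd : (fun w => ∑ k ∈ Finset.range 2, homogeneousPart d k w) =O[𝓝 0] fun w => ‖w‖ ^ 2 := by
    have h := hR.sub ((hTaylor.comp_tendsto ht).congr_right (g₂ := fun w => ‖w‖ ^ 2)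
      fun w => by simp [Prod.norm_def])
    refine h.congr_left fun w => ?_
    have hre : ((2 * w.re : ℝ) : ℂ) = w + (starRingEnd ℂ) w := (Complex.add_conj w).symm
    push_cast at hre
    simp [d, homogeneousPart, Finset.sum_product, Finset.sum_range_succ, hF0, hR₁0, hre,
      Finset.Nat.antidiagonal_succ]
    ring
  constructor
  · have := coeff_eq_zero_of_sum_homogeneousPart_isBigO hd (a := 1) (b := 0) (by norm_num)
    simpa [d, sub_eq_zero] using this
  · have := coeff_eq_zero_of_sum_homogeneousPart_isBigO hd (a := 0) (b := 1) (by norm_num)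
    simpa [d, sub_eq_zero] using this

theorem tangency_reduce_to_leading_term {F R₁ : ℂ → ℝ} {R₂ : ℂ × ℂ → ℝ} {C : ℝ}
    (hR₁ : R₁ =O[𝓝 0] fun t : ℂ => ‖t‖ ^ 1)
    (hR₂ : ∀ᶠ q in 𝓝 (0 : ℂ × ℂ), |R₂ q| ≤ C * q.2.im ^ 2)
    {γ : ℂ → ℂ} (hγc : ContinuousAt γ 0) (hγ0 : γ 0 = 0) {n : ℕ} (hn : 1 ≤ n) {a : ℂ}
    (hγ : (fun t => γ t - a * t ^ n) =O[𝓝 0] fun t : ℂ => ‖t‖ ^ (n + 1))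
    (htan : (fun t : ℂ => 2 * (γ t).re + F t + R₁ t * (γ t).im + R₂ (t, γ t))
      =O[𝓝 0] fun t : ℂ => ‖t‖ ^ (n + 1)) :
    (fun t : ℂ => 2 * (a * t ^ n).re + F t) =O[𝓝 0] fun t : ℂ => ‖t‖ ^ (n + 1) := by
  have hγn : γ =O[𝓝 0] fun t : ℂ => ‖t‖ ^ n := by
    have h2 : (fun t : ℂ => a * t ^ n) =O[𝓝 0] fun t : ℂ => ‖t‖ ^ n :=
      IsBigO.of_bound ‖a‖ (Eventually.of_forall fun t => by simp)
    simpa using (hγ.trans (isBigO_norm_pow_of_le n.le_succ)).add h2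
  have him : (fun t => (γ t).im) =O[𝓝 0] fun t : ℂ => ‖t‖ ^ n :=
    (IsBigO.of_bound 1 (Eventually.of_forall fun t => by
      simpa using Complex.abs_im_le_norm (γ t))).trans hγn
  have h1 : (fun t => R₁ t * (γ t).im) =O[𝓝 0] fun t : ℂ => ‖t‖ ^ (n + 1) :=
    (hR₁.mul him).congr_right fun t => by ring
  have ht : Tendsto (fun t : ℂ => (t, γ t)) (𝓝 0) (𝓝 (0 : ℂ × ℂ)) := by
    have : ContinuousAt (fun t : ℂ => (t, γ t)) 0 := continuousAt_id.prodMk hγc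
    rwa [ContinuousAt, hγ0] at this
  have h2 : (fun t => R₂ (t, γ t)) =O[𝓝 0] fun t : ℂ => ‖t‖ ^ (n + 1) := by
    have hb : (fun t => R₂ (t, γ t)) =O[𝓝 0] fun t => (γ t).im * (γ t).im := by
      refine IsBigO.of_bound |C| ?_
      filter_upwards [ht.eventually hR₂] with t h
      rw [Real.norm_eq_abs, ← pow_two, norm_pow, Real.norm_eq_abs, sq_abs]
      exact h.trans (mul_le_mul_of_nonneg_right (le_abs_self C) (sq_nonneg _))
    refine (hb.trans (him.mul him)).trans ?_
    simp_rw [← pow_add]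
    exact isBigO_norm_pow_of_le (by omega)
  have h3 : (fun t => 2 * (γ t - a * t ^ n).re) =O[𝓝 0] fun t : ℂ => ‖t‖ ^ (n + 1) :=
    ((IsBigO.of_bound 1 (Eventually.of_forall fun t => by
      simpa using Complex.abs_re_le_norm (γ t - a * t ^ n))).trans hγ).const_mul_left 2
  refine (((htan.sub h1).sub h2).sub h3).congr_left fun t => ?_
  rw [Complex.sub_re]
  ring

theorem isBigO_sub_of_eventuallyEq_pow_mul {γ g : ℂ → ℂ} {n : ℕ} (hg : AnalyticAt ℂ g 0)
    (h : γ =ᶠ[𝓝 0] fun t => t ^ n * g t) :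
    (fun t => γ t - g 0 * t ^ n) =O[𝓝 0] fun t : ℂ => ‖t‖ ^ (n + 1) := by
  obtain ⟨k, hk, hgk⟩ := hg.exists_eq_add_mul
  have hO : (fun t : ℂ => t ^ (n + 1) * k t) =O[𝓝 0] fun t : ℂ => ‖t‖ ^ (n + 1) := by
    have h1 : (fun t : ℂ => t ^ (n + 1)) =O[𝓝 0] fun t : ℂ => ‖t‖ ^ (n + 1) :=
      IsBigO.of_bound 1 (Eventually.of_forall fun t => by simp)
    simpa using h1.mul (hk.continuousAt.norm.isBoundedUnder_le.isBigO_one ℝ)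
  refine hO.congr' ?_ EventuallyEq.rfl
  filter_upwards [h] with t ht
  rw [ht, hgk t]
  ring

theorem leading_term_of_tangent_curve {m : ℕ} (hm : 1 ≤ m) {F R₁ : ℂ → ℝ} {R₂ : ℂ × ℂ → ℝ} {C : ℝ}
    {d : ℂ} (hF : (fun t : ℂ => F t + 2 * (d * t ^ m).re) =O[𝓝 0] fun t : ℂ => ‖t‖ ^ (m + 1))
    (hFm : F =O[𝓝 0] fun t : ℂ => ‖t‖ ^ m)
    (hR₁ : R₁ =O[𝓝 0] fun t : ℂ => ‖t‖ ^ 1)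
    (hR₂ : ∀ᶠ q in 𝓝 (0 : ℂ × ℂ), |R₂ q| ≤ C * q.2.im ^ 2)
    {γ : ℂ → ℂ} (hγ : AnalyticAt ℂ γ 0) (hγ0 : γ 0 = 0)
    (htan : ∀ N : ℕ, (fun t : ℂ => 2 * (γ t).re + F t + R₁ t * (γ t).im + R₂ (t, γ t))
      =O[𝓝 0] fun t : ℂ => ‖t‖ ^ N) :
    (fun t => γ t - d * t ^ m) =O[𝓝 0] fun t : ℂ => ‖t‖ ^ (m + 1) := by
  have reduce : ∀ n, 1 ≤ n → ∀ g : ℂ → ℂ, AnalyticAt ℂ g 0 → (γ =ᶠ[𝓝 0] fun t => t ^ n * g t) →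
      (fun t : ℂ => 2 * (g 0 * t ^ n).re + F t) =O[𝓝 0] fun t : ℂ => ‖t‖ ^ (n + 1) :=
    fun n hn g hg h => tangency_reduce_to_leading_term hR₁ hR₂ hγ.continuousAt hγ0 hn
      (isBigO_sub_of_eventuallyEq_pow_mul hg h) (htan (n + 1))
  have factor : ∀ n, 1 ≤ n → n ≤ m →
      ∃ g : ℂ → ℂ, AnalyticAt ℂ g 0 ∧ γ =ᶠ[𝓝 0] fun t => t ^ n * g t := by
    intro n hn
    induction n, hn using Nat.le_induction with
    | base =>
      intro _
      obtain ⟨g, hg, h⟩ := hγ.exists_eq_add_mul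
      exact ⟨g, hg, Eventually.of_forall fun t => by simp [h t, hγ0]⟩
    | succ n hn ih =>
      intro hnm
      obtain ⟨g, hg, h⟩ := ih (by omega)
      have hg0 : g 0 = 0 := eq_zero_of_re_mul_pow_isBigO hn <|
        ((reduce n hn g hg h).sub (hFm.trans (isBigO_norm_pow_of_le hnm))).congr_left
          fun t => by ring
      obtain ⟨k, hk, hgk⟩ := hg.exists_eq_add_mul
      refine ⟨k, hk, h.trans (Eventually.of_forall fun t => ?_)⟩
      simp only [hgk t, hg0]
      ring
  obtain ⟨g, hg, h⟩ := factor m hm le_rfl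
  have hgd : g 0 - d = 0 := eq_zero_of_re_mul_pow_isBigO hm <|
    ((reduce m hm g hg h).sub hF).congr_left fun t => by
      rw [sub_mul, Complex.sub_re]
      ring
  rw [← sub_eq_zero.1 hgd]
  exact isBigO_sub_of_eventuallyEq_pow_mul hg h

/-- Let `F(z,z̄)` be a smooth real-valued function near `0 ∈ ℂ` with
`ord F = m < ∞`, and let `r(z,w) = 2 Re w + F(z,z̄) + R₁·Im w + R₂` be a defining
function of a hypersurface `M ⊆ ℂ²` in a standard coordinate, with Taylor
coefficients `c α β` (exponents `α, β ∈ ℕ²` in `(z,w)`).  Then the Newton polyhedron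
of `r` is `{ξ ∈ ℝ₊² : ξ₁/m + ξ₂ ≥ 1}`; and, provided the `{ξ₁/m + ξ₂ = 1}`-facet
part of `r` is `N`-degenerate, every holomorphic curve with first component `t`
tangent to `M` at `0` to infinite order has the form
`γ(t) = (t, c₀ t^m + O(t^{m+1}))` with `c₀ ≠ 0`. -/
theorem statement19 (m : ℕ) (hm : 1 ≤ m) (F R₁ : ℂ → ℝ) (R₂ : ℂ × ℂ → ℝ) (C : ℝ)
    (hF : ContDiff ℝ (⊤ : ℕ∞) F) (hF0 : F 0 = 0) (hdF : fderiv ℝ F 0 = 0)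
    (hFlow : ∀ k < m, iteratedFDeriv ℝ k F 0 = 0)
    (hFm : iteratedFDeriv ℝ m F 0 ≠ 0)
    (hR₁ : ContDiff ℝ (⊤ : ℕ∞) R₁) (hR₁0 : R₁ 0 = 0)
    (hR₂ : ContDiff ℝ (⊤ : ℕ∞) R₂)
    (hR₂bd : ∀ᶠ q in 𝓝 (0 : ℂ × ℂ), |R₂ q| ≤ C * q.2.im ^ 2)
    (c : ℕ × ℕ → ℕ × ℕ → ℂ)
    (hTaylor : ∀ N : ℕ,
      (fun q : ℂ × ℂ =>
        ((2 * q.2.re + F q.1 + R₁ q.1 * q.2.im + R₂ q : ℝ) : ℂ) -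
        ∑ α ∈ Finset.range N ×ˢ Finset.range N,
          ∑ β ∈ Finset.range N ×ˢ Finset.range N,
            if α.1 + α.2 + β.1 + β.2 < N then
              c α β * q.1 ^ α.1 * q.2 ^ α.2 *
                (starRingEnd ℂ) q.1 ^ β.1 * (starRingEnd ℂ) q.2 ^ β.2
            else 0)
        =O[𝓝 0] fun q => ‖q‖ ^ N) :
    (NewtonPolyhedron2 {ξ | ∃ α β, c α β ≠ 0 ∧ ξ = α + β} =
      {ξ : ℝ × ℝ | 0 ≤ ξ.1 ∧ 0 ≤ ξ.2 ∧ 1 ≤ ξ.1 / m + ξ.2}) ∧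
    ((∃ c₁ c₂ : ℂ, c₁ ≠ 0 ∧ c₂ ≠ 0 ∧ ∀ t : ℂ,
        (∑ a ∈ Finset.range (m + 1),
          c (a, 0) (m - a, 0) * (c₁ * t) ^ a * (starRingEnd ℂ) (c₁ * t) ^ (m - a)) +
          c (0, 1) (0, 0) * (c₂ * t ^ m) +
          c (0, 0) (0, 1) * (starRingEnd ℂ) (c₂ * t ^ m) = 0) →
      ∀ γ₂ : ℂ → ℂ, AnalyticAt ℂ γ₂ 0 → γ₂ 0 = 0 →
        (∀ N : ℕ,
          (fun t : ℂ => 2 * (γ₂ t).re + F t + R₁ t * (γ₂ t).im + R₂ (t, γ₂ t))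
            =O[𝓝 0] fun t : ℂ => t ^ N) →
        ∃ c₀ : ℂ, c₀ ≠ 0 ∧
          (fun t : ℂ => γ₂ t - c₀ * t ^ m) =O[𝓝 0] fun t : ℂ => t ^ (m + 1)) := by
  have hR₂z : ∀ᶠ z in 𝓝 (0 : ℂ), R₂ (z, 0) = 0 := by
    have ht : Tendsto (fun z : ℂ => (z, (0 : ℂ))) (𝓝 0) (𝓝 0) :=
      (Continuous.prodMk_left (0 : ℂ)).tendsto 0
    filter_upwards [ht.eventually hR₂bd] with z hz
    simpa using hz
  obtain ⟨hc₁, hc₂⟩ := taylor_linear_coeff_second_variable hF0 hR₁0 hR₂bd (hTaylor 2)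
  set e : ℕ → ℕ → ℂ := fun a b => c (a, 0) (b, 0)
  have hFO : F =O[𝓝 0] fun z : ℂ => ‖z‖ ^ m := isBigO_of_iteratedFDeriv_eq_zero hF hFlow
  have hlow : ∀ a b, a + b < m → e a b = 0 := by
    intro a b hab
    have h := (Complex.isBigO_ofReal_left.2 hFO).sub
      (taylor_first_variable hm hR₂z (hTaylor m))
    simp only [sub_sub_cancel] at h
    exact coeff_eq_zero_of_sum_homogeneousPart_isBigO h hab
  have hlead : (fun z => (F z : ℂ) - homogeneousPart e m z) =O[𝓝 0] fun z => ‖z‖ ^ (m + 1) := by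
    refine (taylor_first_variable m.succ_pos hR₂z (hTaylor (m + 1))).congr_left fun z => ?_
    rw [Finset.sum_range_succ, Finset.sum_eq_zero, zero_add]
    intro k hk
    refine Finset.sum_eq_zero fun p hp => ?_
    have hp' := Finset.HasAntidiagonal.mem_antidiagonal.1 hp
    have hk' := Finset.mem_range.1 hk
    change e p.1 p.2 * _ * _ = 0
    rw [hlow p.1 p.2 (by omega), zero_mul, zero_mul]
  refine ⟨newtonPolyhedron2_eq hm ?_ ?_ ?_, ?_⟩
  · by_contra hne
    refine hFm (iteratedFDeriv_eq_zero_of_isBigO hF hFlow ?_)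
    have hz : ∀ z, homogeneousPart e m z = 0 := by
      refine fun z => Finset.sum_eq_zero fun p hp => ?_
      have hp' := Finset.HasAntidiagonal.mem_antidiagonal.1 hp
      have : e p.1 p.2 = 0 := by
        by_contra h
        exact hne ⟨(p.1, 0), (p.2, 0), h, by simp [hp']⟩
      rw [this, zero_mul, zero_mul]
    simp only [hz, sub_zero] at hlead
    exact Complex.isBigO_ofReal_left.1 hlead
  · exact ⟨(0, 1), (0, 0), by simp [hc₁], by simp⟩
  · rintro _ ⟨⟨a, a'⟩, ⟨b, b'⟩, hne, rfl⟩ h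
    simp only [Prod.mk_add_mk, Nat.add_eq_zero_iff] at h ⊢
    obtain ⟨rfl, rfl⟩ := h
    by_contra hlt
    exact hne (hlow a b (not_le.1 hlt))
  · rintro ⟨c₁, c₂, h₁, h₂, hdeg⟩ γ hγ hγ0 htan
    have hform : ∀ z, homogeneousPart e m z = ((-(2 * (c₂ / c₁ ^ m * z ^ m).re) : ℝ) : ℂ) := by
      intro z
      have h := hdeg (z / c₁)
      rw [mul_div_cancel₀ z h₁, hc₁, hc₂, one_mul, one_mul, add_assoc, Complex.add_conj] at h
      have hs : homogeneousPart e m z = ∑ a ∈ Finset.range (m + 1),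
          c (a, 0) (m - a, 0) * z ^ a * (starRingEnd ℂ) z ^ (m - a) :=
        Finset.Nat.sum_antidiagonal_eq_sum_range_succ
          (fun a b => e a b * z ^ a * (starRingEnd ℂ) z ^ b) m
      rw [hs, eq_neg_of_add_eq_zero_left h, div_pow, ← mul_div_right_comm, mul_div_assoc]
      push_cast
      ring
    refine ⟨c₂ / c₁ ^ m, div_ne_zero h₂ (pow_ne_zero m h₁), ?_⟩
    have hF' : (fun t : ℂ => F t + 2 * (c₂ / c₁ ^ m * t ^ m).re)
        =O[𝓝 0] fun t : ℂ => ‖t‖ ^ (m + 1) := by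
      refine Complex.isBigO_ofReal_left.1 (hlead.congr_left fun t => ?_)
      rw [hform]
      push_cast
      ring
    have hR₁O : R₁ =O[𝓝 0] fun t : ℂ => ‖t‖ ^ 1 := by
      have := (hR₁.differentiable (by simp)).differentiableAt.isBigO_sub (x₀ := (0 : ℂ))
      simpa [hR₁0] using this.norm_right
    have hpow : ∀ N : ℕ, (fun t : ℂ => ‖t ^ N‖) = fun t : ℂ => ‖t‖ ^ N :=
      fun N => funext fun t => norm_pow t N
    refine IsBigO.of_norm_right ?_
    rw [hpow]
    refine leading_term_of_tangent_curve hm hF' hFO hR₁O hR₂bd hγ hγ0 fun N => ?_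
    rw [← hpow]
    exact (htan N).norm_right
end
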